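/- arXiv:1512.05335 — 3 statements merged into one kernel-verified Lean document; each statement's English description precedes it below -/
import Mathlib

section
/- There exist universal constants c₁, c₂ > 0 such that for all reals 0 < a < b and all p > p_c, the probability that every rectangle of the form B_a(2ax) ∪ B_a(2ax'), with x, x' ∈ B_{⌈b/(2a)⌉+1} ∩ ℤ² adjacent in ℤ², contains a p-black crossing in its long direction is at least 1 − c₁ (b/a)² e^{−c₂ a / L(p)}. -/
open MeasureTheory ProbabilityTheory Filter

noncomputable section

namespace FrozenPercolation

/-- Sites of the triangular lattice, coordinatized by `ℤ × ℤ`. -/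
abbrev Site : Type := ℤ × ℤ

/-- The embedding `(x, y) ↦ x + y·e^{iπ/3}` of the sites into `ℂ`. -/
def embed (v : Site) : ℂ :=
  (v.1 : ℂ) + (v.2 : ℂ) * Complex.exp (Complex.I * (Real.pi / 3))

/-- The triangular lattice: two sites are adjacent iff their embeddings are at
Euclidean distance `1`. -/
def Tri : SimpleGraph Site where
  Adj u v := dist (embed u) (embed v) = 1
  symm.symm u v h := by
    show dist (embed v) (embed u) = 1
    rwa [dist_comm]
  loopless.irrefl u h := by
    have : dist (embed u) (embed u) = 1 := h
    rw [dist_self] at this; norm_num at this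

/-- The subgraph of `G` induced by the vertices of `S` (viewed as a graph on all sites). -/
def restrictGraph (G : SimpleGraph Site) (S : Set Site) : SimpleGraph Site where
  Adj u v := G.Adj u v ∧ u ∈ S ∧ v ∈ S
  symm.symm u v h := ⟨G.adj_symm h.1, h.2.2, h.2.1⟩
  loopless.irrefl u h := G.loopless.irrefl u h.1

/-- In the standard coupling by i.i.d. uniform labels, `v` is `p`-black iff its
label is at most `p`. -/
def Black (p : ℝ) (ω : Site → ℝ) (v : Site) : Prop := ω v ≤ p

/-- The graph on the `p`-black sites. -/
def blackGraph (p : ℝ) (ω : Site → ℝ) : SimpleGraph Site :=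
  restrictGraph Tri {v | Black p ω v}

/-- `u ⟷ v`: `u` and `v` are joined by a path of `p`-black sites. -/
def Conn (p : ℝ) (ω : Site → ℝ) (u v : Site) : Prop :=
  Black p ω u ∧ Black p ω v ∧ (blackGraph p ω).Reachable u v

/-- `u` and `v` are joined by a `p`-black path staying inside `S`. -/
def ConnIn (p : ℝ) (ω : Site → ℝ) (S : Set Site) (u v : Site) : Prop :=
  u ∈ S ∧ v ∈ S ∧ Black p ω u ∧ Black p ω v ∧
    (restrictGraph (blackGraph p ω) S).Reachable u v

/-- The `p`-black cluster of `v`. -/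
def cluster (p : ℝ) (ω : Site → ℝ) (v : Site) : Set Site := {u | Conn p ω v u}

/-- `v ⟷ ∞` : `v` lies in an infinite `p`-black cluster. -/
def ConnInf (p : ℝ) (ω : Site → ℝ) (v : Site) : Prop :=
  Black p ω v ∧ (cluster p ω v).Infinite

/-- The infinite `p`-black cluster. -/
def Cinf (p : ℝ) (ω : Site → ℝ) : Set Site := {v | ConnInf p ω v}

/-- Inner (vertex) boundary of `S`. -/
def innerBdry (S : Set Site) : Set Site := {v | v ∈ S ∧ ∃ u, u ∉ S ∧ Tri.Adj v u}

/-- Outer (vertex) boundary of `S`. -/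
def outBdry (S : Set Site) : Set Site := {v | v ∉ S ∧ ∃ u, u ∈ S ∧ Tri.Adj v u}

/-- The box `B_r` : sites embedded in `[-r, r]²`. -/
def box (r : ℝ) : Set Site := {v | |(embed v).re| ≤ r ∧ |(embed v).im| ≤ r}

/-- The box `B_r(z)`. -/
def boxAt (r : ℝ) (z : ℂ) : Set Site :=
  {v | |(embed v - z).re| ≤ r ∧ |(embed v - z).im| ≤ r}

/-- The probability (as a real number) of an event under `μ`. -/
def prob (μ : Measure (Site → ℝ)) (E : Set (Site → ℝ)) : ℝ := (μ E).toReal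

/-- `μ` is the standard coupling of all the percolation parameters: under `μ` the
labels `(ω v)_{v ∈ Site}` are i.i.d., uniformly distributed on `[0, 1]`. -/
def IsUniformCoupling (μ : Measure (Site → ℝ)) : Prop :=
  IsProbabilityMeasure μ ∧
  iIndepFun (m := fun _ : Site => (inferInstance : MeasurableSpace ℝ)) (fun v ω => ω v) μ ∧
  ∀ v : Site, μ.map (fun ω => ω v) = volume.restrict (Set.Icc (0 : ℝ) 1)

/-- The critical point of site percolation on the triangular lattice. -/
def pc : ℝ := 1 / 2

/-- `θ(p)`: the density of the infinite `p`-black cluster. -/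
def theta (μ : Measure (Site → ℝ)) (p : ℝ) : ℝ := prob μ {ω | ConnInf p ω 0}

/-- Sites embedded in the rectangle `[x₁, x₂] × [y₁, y₂]`. -/
def rectSites (x₁ x₂ y₁ y₂ : ℝ) : Set Site :=
  {v | (embed v).re ∈ Set.Icc x₁ x₂ ∧ (embed v).im ∈ Set.Icc y₁ y₂}

/-- Horizontal `p`-black crossing of the rectangle `[x₁, x₂] × [y₁, y₂]`
(a `p`-black path in the rectangle joining its two vertical sides). -/
def HCross (p : ℝ) (ω : Site → ℝ) (x₁ x₂ y₁ y₂ : ℝ) : Prop :=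
  ∃ u v, ConnIn p ω (rectSites x₁ x₂ y₁ y₂) u v ∧
    (embed u).re ≤ x₁ + 1 ∧ x₂ - 1 ≤ (embed v).re

/-- The characteristic length, as a natural number. -/
def Lnat (μ : Measure (Site → ℝ)) (p : ℝ) : ℕ :=
  if p < pc then sSup {n : ℕ | (1 : ℝ) / 100 ≤ prob μ {ω | HCross p ω 0 n 0 (2 * n)}}
  else sSup {n : ℕ | (1 : ℝ) / 100 ≤ prob μ {ω | HCross (1 - p) ω 0 n 0 (2 * n)}}

/-- The characteristic length `L(p)`. -/
def charL (μ : Measure (Site → ℝ)) (p : ℝ) : ℝ := (Lnat μ p : ℝ)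

/-- `v` is adjacent to the set `S`. -/
def AdjSet (v : Site) (S : Set Site) : Prop := ∃ w ∈ S, Tri.Adj v w

/-- One-arm event: a `p`-black path in `B_n`, from `B_m` (or a neighbour of it)
to the inner boundary of `B_n`. -/
def ArmEvent (p m n : ℝ) : Set (Site → ℝ) :=
  {ω | ∃ u v, ConnIn p ω (box n) u v ∧ (u ∈ box m ∨ AdjSet u (box m)) ∧
        v ∈ innerBdry (box n)}

/-- `π₁(m, n)`: the critical one-arm probability from scale `m` to scale `n`. -/
def pi1 (μ : Measure (Site → ℝ)) (m n : ℝ) : ℝ := prob μ (ArmEvent pc m n)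

/-- `π₁(n) = π₁(0, n)`: the critical one-arm probability from the origin to `∂B_n`. -/
def pi1n (μ : Measure (Site → ℝ)) (n : ℝ) : ℝ := pi1 μ 0 n

/-- The set removed when defining the hole of the origin: the infinite cluster
together with its outer boundary. -/
def holeCoRegion (p : ℝ) (ω : Site → ℝ) : Set Site := Cinf p ω ∪ outBdry (Cinf p ω)

/-- The hole `H(p)` of the origin in the infinite `p`-black cluster. -/
def hole (p : ℝ) (ω : Site → ℝ) : Set Site :=
  {u | (0 : Site) ∉ holeCoRegion p ω ∧ u ∉ holeCoRegion p ω ∧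
       (restrictGraph Tri (holeCoRegion p ω)ᶜ).Reachable 0 u}

/-- `S` induces a connected subgraph of the triangular lattice. -/
def ConnectedOn (S : Set Site) : Prop :=
  ∀ u ∈ S, ∀ v ∈ S, (restrictGraph Tri S).Reachable u v

/-- A finite simply connected domain: both `Λ` and its complement induce
connected subgraphs. -/
def SCDomain (Λ : Set Site) : Prop :=
  Λ.Finite ∧ ConnectedOn Λ ∧ ConnectedOn Λᶜ

/-- `𝒞_Λ(p)`: the `p`-black vertices joined to the inner boundary of `Λ`
by `p`-black paths inside `Λ`. -/
def domCluster (p : ℝ) (ω : Site → ℝ) (Λ : Set Site) : Set Site :=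
  {v | ∃ w, w ∈ innerBdry Λ ∧ ConnIn p ω Λ v w}

/-- The set removed when defining `H^{(Λ)}(p)`. -/
def removedIn (p : ℝ) (ω : Site → ℝ) (Λ : Set Site) : Set Site :=
  innerBdry Λ ∪ domCluster p ω Λ ∪ outBdry (domCluster p ω Λ)

/-- `H^{(Λ)}(p)`: the hole of the origin seen from the domain `Λ`. -/
def holeIn (p : ℝ) (ω : Site → ℝ) (Λ : Set Site) : Set Site :=
  {u | (0 : Site) ∉ removedIn p ω Λ ∧ u ∉ removedIn p ω Λ ∧
       (restrictGraph Tri (removedIn p ω Λ)ᶜ).Reachable 0 u}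

/-- The `p`-black cluster of `v` inside `S`. -/
def clusterIn (p : ℝ) (ω : Site → ℝ) (S : Set Site) (v : Site) : Set Site :=
  {u | ConnIn p ω S v u}

/-- The volume of a largest `p`-black cluster of `S`. -/
def maxClusterVol (p : ℝ) (ω : Site → ℝ) (S : Set Site) : ℕ :=
  sSup {k : ℕ | ∃ v ∈ S, k = (clusterIn p ω S v).ncard}

/-- The volume of a largest `p`-black cluster of `S` contained in the infinite
cluster. -/
def maxClusterVolInf (p : ℝ) (ω : Site → ℝ) (S : Set Site) : ℕ :=
  sSup {k : ℕ | ∃ v ∈ S, ConnInf p ω v ∧ k = (clusterIn p ω S v).ncard}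

/-- The volume of a largest `p`-black cluster of `S` not contained in the infinite
cluster. -/
def maxClusterVolFin (p : ℝ) (ω : Site → ℝ) (S : Set Site) : ℕ :=
  sSup {k : ℕ | ∃ v ∈ S, Black p ω v ∧ ¬ ConnInf p ω v ∧ k = (clusterIn p ω S v).ncard}

/-- `𝒱_n`: the number of sites of `B_n` joined to `∂B_{2n}` by a `p`-black path. -/
def VolConn (p n : ℝ) (ω : Site → ℝ) : ℕ :=
  ({v | v ∈ box n ∧ ∃ w, w ∈ innerBdry (box (2 * n)) ∧ Conn p ω v w}).ncard

/-- The centre `2a·x` of the `2a × 2a` square indexed by `x ∈ ℤ²`. -/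
def ctr (a : ℝ) (x : ℤ × ℤ) : ℂ := 2 * a * ((x.1 : ℂ) + (x.2 : ℂ) * Complex.I)

/-- The (unit) direction from `x` to `x'`, as a complex number. -/
def dirC (x x' : ℤ × ℤ) : ℂ :=
  ((x'.1 - x.1 : ℤ) : ℂ) + ((x'.2 - x.2 : ℤ) : ℂ) * Complex.I

/-- Adjacency in `ℤ²`. -/
def IntAdj (x x' : ℤ × ℤ) : Prop := (x.1 - x'.1).natAbs + (x.2 - x'.2).natAbs = 1

/-- A `p`-black crossing of the rectangle `B_a(2ax) ∪ B_a(2ax')` in its long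
direction: a `p`-black path in the rectangle joining its two short sides. -/
def LongCross (p a : ℝ) (ω : Site → ℝ) (x x' : ℤ × ℤ) : Prop :=
  ∃ u v, ConnIn p ω (boxAt a (ctr a x) ∪ boxAt a (ctr a x')) u v ∧
    ((embed u - ctr a x) * (starRingEnd ℂ) (dirC x x')).re ≤ -a + 1 ∧
    3 * a - 1 ≤ ((embed v - ctr a x) * (starRingEnd ℂ) (dirC x x')).re

/-- The integer box of radius `r` in `ℤ²`. -/
def intBox (r : ℤ) : Set (ℤ × ℤ) := {x | |x.1| ≤ r ∧ |x.2| ≤ r}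

/-- The net event `Net_p(a, b)`: every rectangle `B_a(2ax) ∪ B_a(2ax')`, for
`x, x'` adjacent in the integer box of radius `⌈b/(2a)⌉ + 1`, has a `p`-black
crossing in its long direction. -/
def NetEvent (p a b : ℝ) : Set (Site → ℝ) :=
  {ω | ∀ x x' : ℤ × ℤ, x ∈ intBox (⌈b / (2 * a)⌉ + 1) →
        x' ∈ intBox (⌈b / (2 * a)⌉ + 1) → IntAdj x x' → LongCross p a ω x x'}


/-! ### Geometry of the lattice -/

lemma embed_re (v : Site) : (embed v).re = v.1 + v.2 / 2 := by
  have h : Complex.exp (Complex.I * (Real.pi / 3)) = (1/2 : ℝ) + (Real.sqrt 3 / 2 : ℝ) * Complex.I := by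
    have e : Complex.I * ((Real.pi : ℂ) / 3) = ((Real.pi / 3 : ℝ) : ℂ) * Complex.I := by
      push_cast; ring
    rw [e, Complex.exp_mul_I, ← Complex.ofReal_cos, ← Complex.ofReal_sin, Real.cos_pi_div_three,
      Real.sin_pi_div_three]
  simp only [embed, h]
  simp
  ring

lemma embed_im (v : Site) : (embed v).im = v.2 * (Real.sqrt 3 / 2) := by
  have h : Complex.exp (Complex.I * (Real.pi / 3)) = (1/2 : ℝ) + (Real.sqrt 3 / 2 : ℝ) * Complex.I := by
    have e : Complex.I * ((Real.pi : ℂ) / 3) = ((Real.pi / 3 : ℝ) : ℂ) * Complex.I := by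
      push_cast; ring
    rw [e, Complex.exp_mul_I, ← Complex.ofReal_cos, ← Complex.ofReal_sin, Real.cos_pi_div_three,
      Real.sin_pi_div_three]
  simp only [embed, h]
  simp

lemma adj_iff (u v : Site) : Tri.Adj u v ↔
    (u.1 - v.1) ^ 2 + (u.1 - v.1) * (u.2 - v.2) + (u.2 - v.2) ^ 2 = 1 := by
  have h0 : Tri.Adj u v ↔ dist (embed u) (embed v) = 1 := Iff.rfl
  have h3 : Real.sqrt 3 ^ 2 = 3 := Real.sq_sqrt (by norm_num)
  rw [h0, Complex.dist_eq_re_im, Real.sqrt_eq_one, embed_re, embed_re, embed_im, embed_im]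
  have : ((u.1 : ℝ) + u.2 / 2 - (v.1 + v.2 / 2)) ^ 2 +
      (u.2 * (Real.sqrt 3 / 2) - v.2 * (Real.sqrt 3 / 2)) ^ 2 =
      (((u.1 - v.1) ^ 2 + (u.1 - v.1) * (u.2 - v.2) + (u.2 - v.2) ^ 2 : ℤ) : ℝ) := by
    push_cast
    linear_combination ((u.2 : ℝ) - v.2) ^ 2 / 4 * h3
  rw [this]
  norm_cast

lemma quad_one {a b : ℤ} (h : a ^ 2 + a * b + b ^ 2 = 1) :
    (a = 1 ∧ b = 0) ∨ (a = -1 ∧ b = 0) ∨ (a = 0 ∧ b = 1) ∨ (a = 0 ∧ b = -1) ∨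
    (a = 1 ∧ b = -1) ∨ (a = -1 ∧ b = 1) := by
  have ha : a ≤ 1 := by nlinarith [sq_nonneg (a + 2 * b)]
  have ha' : -1 ≤ a := by nlinarith [sq_nonneg (a + 2 * b)]
  have hb : b ≤ 1 := by nlinarith [sq_nonneg (b + 2 * a)]
  have hb' : -1 ≤ b := by nlinarith [sq_nonneg (b + 2 * a)]
  interval_cases a <;> interval_cases b <;> simp_all

lemma adj_cases {u v : Site} (h : Tri.Adj u v) :
    (u.1 - v.1 = 1 ∧ u.2 - v.2 = 0) ∨ (u.1 - v.1 = -1 ∧ u.2 - v.2 = 0) ∨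
    (u.1 - v.1 = 0 ∧ u.2 - v.2 = 1) ∨ (u.1 - v.1 = 0 ∧ u.2 - v.2 = -1) ∨
    (u.1 - v.1 = 1 ∧ u.2 - v.2 = -1) ∨ (u.1 - v.1 = -1 ∧ u.2 - v.2 = 1) :=
  quad_one ((adj_iff u v).1 h)

/-- The three linear functionals (twice the projections in the directions 0, 60 degrees, and so on). -/
def fA (v : Site) : ℤ := 2 * v.1 + v.2
def fB (v : Site) : ℤ := v.1 - v.2
def fC (v : Site) : ℤ := v.1 + 2 * v.2

/-- steps of size at most `2`. -/
def Lip (G : Site → ℤ) : Prop := ∀ u v, Tri.Adj u v → |G u - G v| ≤ 2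

lemma lip_A : Lip fA := by
  intro u v h
  rw [abs_le]
  rcases adj_cases h with h | h | h | h | h | h <;> simp only [fA] <;> omega
lemma lip_B : Lip fB := by
  intro u v h
  rw [abs_le]
  rcases adj_cases h with h | h | h | h | h | h <;> simp only [fB] <;> omega
lemma lip_C : Lip fC := by
  intro u v h
  rw [abs_le]
  rcases adj_cases h with h | h | h | h | h | h <;> simp only [fC] <;> omega

/-- `J D u v`: `u` and `v` are joined by a lattice path in `D`. -/
inductive J (D : Set Site) (u : Site) : Site → Prop
  | refl : u ∈ D → J D u u
  | step {v w : Site} : J D u v → Tri.Adj v w → w ∈ D → J D u w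

namespace J

lemma left_mem {D : Set Site} {u v : Site} (h : J D u v) : u ∈ D := by
  induction h with
  | refl h => exact h
  | step _ _ _ ih => exact ih

lemma right_mem {D : Set Site} {u v : Site} (h : J D u v) : v ∈ D := by
  cases h with
  | refl h => exact h
  | step _ _ h => exact h

lemma mono {D D' : Set Site} (hD : D ⊆ D') {u v : Site} (h : J D u v) : J D' u v := by
  induction h with
  | refl h => exact .refl (hD h)
  | step _ a m ih => exact .step ih a (hD m)

lemma trans {D : Set Site} {u v w : Site} (h : J D u v) (h' : J D v w) : J D u w := by
  induction h' with
  | refl _ => exact h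
  | step _ a m ih => exact .step ih a m

lemma symm {D : Set Site} {u v : Site} (h : J D u v) : J D v u := by
  induction h with
  | refl h => exact .refl h
  | step h a m ih => exact (J.step (.refl m) (Tri.adj_symm a) h.right_mem).trans ih

/-- the path stays in the component. -/
lemma comp {D : Set Site} {u v : Site} (h : J D u v) : J (D ∩ {x | J D u x}) u v := by
  induction h with
  | refl h => exact .refl ⟨h, .refl h⟩
  | step h a m ih => exact .step ih a ⟨m, J.step h a m⟩

lemma map {D : Set Site} {u v : Site} (f : Site → Site)
    (hf : ∀ a b, Tri.Adj a b → Tri.Adj (f a) (f b)) {D' : Set Site} (hD : ∀ a ∈ D, f a ∈ D')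
    (h : J D u v) : J D' (f u) (f v) := by
  induction h with
  | refl h => exact .refl (hD _ h)
  | step h a m ih => exact .step ih (hf _ _ a) (hD _ m)

/-- first exit from `E`. -/
lemma first_exit {D E : Set Site} {u v : Site} (h : J D u v) (hu : u ∈ E) (hv : v ∉ E) :
    ∃ w w', J (D ∩ E) u w ∧ Tri.Adj w w' ∧ w' ∈ D ∧ w' ∉ E := by
  have key : ∀ x, J D u x → (∃ w w', J (D ∩ E) u w ∧ Tri.Adj w w' ∧ w' ∈ D ∧ w' ∉ E) ∨
      J (D ∩ E) u x := by
    intro x hx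
    induction hx with
    | refl h => exact Or.inr (.refl ⟨h, hu⟩)
    | @step a b hp ad m ih =>
      rcases ih with ih | ih
      · exact Or.inl ih
      · by_cases hb : b ∈ E
        · exact Or.inr (.step ih ad ⟨m, hb⟩)
        · exact Or.inl ⟨a, b, ih, ad, m, hb⟩
  rcases key v h with h | h
  · exact h
  · exact absurd h.right_mem.2 hv

/-- discrete intermediate value lemma. -/
lemma slab {D : Set Site} {u v : Site} (h : J D u v) {G : Site → ℤ} (hG : Lip G) {c w : ℤ}
    (hw : 2 ≤ w) (hu : G u ≤ c + 2) (hv : c + w - 2 ≤ G v) :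
    ∃ u' v', J (D ∩ {x | c ≤ G x ∧ G x ≤ c + w}) u' v' ∧ G u' ≤ c + 2 ∧ c + w - 2 ≤ G v' := by
  set E : Set Site := {x | c ≤ G x ∧ G x ≤ c + w} with hE
  have key : ∀ x, J D u x →
      (∃ u' v', J (D ∩ E) u' v' ∧ G u' ≤ c + 2 ∧ c + w - 2 ≤ G v') ∨ G x < c ∨
      ∃ u', J (D ∩ E) u' x ∧ G u' ≤ c + 2 := by
    intro x hx
    induction hx with
    | refl h =>
      by_cases h1 : G u < c
      · exact Or.inr (Or.inl h1)
      · exact Or.inr (Or.inr ⟨u, .refl ⟨h, by rw [hE]; exact ⟨by omega, by omega⟩⟩, hu⟩)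
    | @step a b hp ad m ih =>
      have hl := abs_le.1 (hG a b ad)
      by_cases hb : G b < c
      · exact Or.inr (Or.inl hb)
      rcases ih with ih | ih | ⟨u', h1, h2⟩
      · exact Or.inl ih
      · exact Or.inr (Or.inr ⟨b, .refl ⟨m, by rw [hE]; exact ⟨by omega, by omega⟩⟩, by omega⟩)
      · by_cases hb' : G b ≤ c + w
        · exact Or.inr (Or.inr ⟨u', .step h1 ad ⟨m, by rw [hE]; exact ⟨by omega, by omega⟩⟩, h2⟩)
        · exact Or.inl ⟨u', a, h1, h2, by omega⟩
  rcases key v h with h | h | ⟨u', h1, h2⟩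
  · exact h
  · exfalso; omega
  · exact ⟨u', v, h1, h2, hv⟩

end J

/-- The set of `q`-black sites. -/
def Bl (q : ℝ) (ω : Site → ℝ) : Set Site := {v | ω v ≤ q}

lemma connIn_of_J {q : ℝ} {ω : Site → ℝ} {S : Set Site} {u v : Site}
    (h : J (S ∩ Bl q ω) u v) : ConnIn q ω S u v := by
  refine ⟨h.left_mem.1, h.right_mem.1, h.left_mem.2, h.right_mem.2, ?_⟩
  induction h with
  | refl h => exact SimpleGraph.Reachable.refl _
  | step h a m ih =>
    refine ih.trans (SimpleGraph.Adj.reachable ?_)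
    exact ⟨⟨a, h.right_mem.2, m.2⟩, h.right_mem.1, m.1⟩



/-! ### Probability: connection events, independence, invariance -/

/-- the event that some `u, v` with `P u v` are joined by a `q`-black path in `D`. -/
def EvJ (q : ℝ) (D : Set Site) (P : Site → Site → Prop) : Set (Site → ℝ) :=
  {ω | ∃ u v, J (D ∩ Bl q ω) u v ∧ P u v}

lemma EvJ_mono {q : ℝ} {D D' : Set Site} {P P' : Site → Site → Prop} (hD : D ⊆ D')
    (hP : ∀ u v, u ∈ D → v ∈ D → P u v → P' u v) : EvJ q D P ⊆ EvJ q D' P' := by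
  rintro ω ⟨u, v, h, hp⟩
  exact ⟨u, v, h.mono (Set.inter_subset_inter_left _ hD), hP u v h.left_mem.1 h.right_mem.1 hp⟩

/-- the sigma-algebra generated by the labels in `D`. -/
def mD (D : Set Site) : MeasurableSpace (Site → ℝ) :=
  ⨆ v ∈ D, MeasurableSpace.comap (fun ω : Site → ℝ => ω v) inferInstance

lemma mD_le (D : Set Site) : mD D ≤ (inferInstance : MeasurableSpace (Site → ℝ)) :=
  iSup₂_le fun v _ => (measurable_pi_apply v).comap_le

lemma mD_mono {D D' : Set Site} (h : D ⊆ D') : mD D ≤ mD D' :=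
  biSup_mono fun _ hv => h hv

lemma meas_black {D : Set Site} {v : Site} (hv : v ∈ D) (q : ℝ) :
    MeasurableSet[mD D] {ω : Site → ℝ | ω v ≤ q} := by
  have h : MeasurableSpace.comap (fun ω : Site → ℝ => ω v) inferInstance ≤ mD D :=
    le_iSup₂_of_le (f := fun v (_ : v ∈ D) =>
      MeasurableSpace.comap (fun ω : Site → ℝ => ω v) inferInstance) v hv le_rfl
  apply h
  exact ⟨Set.Iic q, measurableSet_Iic, rfl⟩

/-- `k`-step version of `J`. -/
def Jn (D : Set Site) (u : Site) : ℕ → Site → Prop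
  | 0, v => v = u ∧ u ∈ D
  | k + 1, v => ∃ w, Jn D u k w ∧ Tri.Adj w v ∧ v ∈ D

lemma J_iff_Jn {D : Set Site} {u v : Site} : J D u v ↔ ∃ k, Jn D u k v := by
  constructor
  · intro h
    induction h with
    | refl h => exact ⟨0, rfl, h⟩
    | step h a m ih =>
      obtain ⟨k, hk⟩ := ih
      exact ⟨k + 1, _, hk, a, m⟩
  · rintro ⟨k, hk⟩
    induction k generalizing v with
    | zero => obtain ⟨rfl, h⟩ := hk; exact .refl h
    | succ k ih => obtain ⟨w, h, a, m⟩ := hk; exact .step (ih h) a m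

lemma meas_mem (q : ℝ) (D : Set Site) (v : Site) :
    MeasurableSet[mD D] {ω : Site → ℝ | v ∈ D ∩ Bl q ω} := by
  by_cases hv : v ∈ D
  · have : {ω : Site → ℝ | v ∈ D ∩ Bl q ω} = {ω : Site → ℝ | ω v ≤ q} := by
      ext ω; simp [Bl, hv]
    rw [this]; exact meas_black hv q
  · have : {ω : Site → ℝ | v ∈ D ∩ Bl q ω} = ∅ := by
      ext ω; simp [hv]
    rw [this]; exact @MeasurableSet.empty _ (mD D)

lemma meas_Jn (q : ℝ) (D : Set Site) (u : Site) (k : ℕ) (v : Site) :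
    MeasurableSet[mD D] {ω : Site → ℝ | Jn (D ∩ Bl q ω) u k v} := by
  induction k generalizing v with
  | zero =>
    by_cases h : v = u
    · have : {ω : Site → ℝ | Jn (D ∩ Bl q ω) u 0 v} = {ω | u ∈ D ∩ Bl q ω} := by
        ext ω; simp [Jn, h]
      rw [this]; exact meas_mem q D u
    · have : {ω : Site → ℝ | Jn (D ∩ Bl q ω) u 0 v} = ∅ := by
        ext ω; simp [Jn, h]
      rw [this]; exact @MeasurableSet.empty _ (mD D)
  | succ k ih =>
    have : {ω : Site → ℝ | Jn (D ∩ Bl q ω) u (k + 1) v} =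
        ⋃ w ∈ {w | Tri.Adj w v}, ({ω | Jn (D ∩ Bl q ω) u k w} ∩ {ω | v ∈ D ∩ Bl q ω}) := by
      ext ω
      simp only [Jn, Set.mem_ofPred_eq, Set.mem_iUnion, Set.mem_inter_iff, exists_prop]
      exact ⟨fun ⟨w, a, b, c⟩ => ⟨w, b, a, c⟩, fun ⟨w, b, a, c⟩ => ⟨w, a, b, c⟩⟩
    rw [this]
    exact MeasurableSet.biUnion (Set.to_countable _)
      fun w _ => MeasurableSet.inter (ih w) (meas_mem q D v)

lemma meas_EvJ (q : ℝ) (D : Set Site) (P : Site → Site → Prop) :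
    MeasurableSet[mD D] (EvJ q D P) := by
  have : EvJ q D P = ⋃ p ∈ {p : Site × Site | P p.1 p.2}, ⋃ k : ℕ,
      {ω | Jn (D ∩ Bl q ω) p.1 k p.2} := by
    ext ω
    simp only [EvJ, J_iff_Jn, Set.mem_ofPred_eq, Set.mem_iUnion, exists_prop]
    exact ⟨fun ⟨u, v, h, p⟩ => ⟨(u, v), p, h⟩, fun ⟨⟨u, v⟩, p, h⟩ => ⟨u, v, h, p⟩⟩
  rw [this]
  exact MeasurableSet.biUnion (Set.to_countable _)
    fun p _ => MeasurableSet.iUnion fun k => meas_Jn q D p.1 k p.2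

lemma meas_EvJ' (q : ℝ) (D : Set Site) (P : Site → Site → Prop) :
    MeasurableSet (EvJ q D P) := mD_le D _ (meas_EvJ q D P)

lemma indep_disj {μ : Measure (Site → ℝ)} (hμ : IsUniformCoupling μ) {D D' : Set Site}
    (hD : Disjoint D D') {s t : Set (Site → ℝ)} (hs : MeasurableSet[mD D] s)
    (ht : MeasurableSet[mD D'] t) : μ.real (s ∩ t) = μ.real s * μ.real t := by
  have h1 := hμ.2.1.iIndep
  have h2 := indep_iSup_of_disjoint (fun v => (measurable_pi_apply v).comap_le) h1 hD
  have h3 := (Indep_iff _ _ _).1 h2 s t hs ht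
  simp only [Measure.real, h3, ENNReal.toReal_mul]

lemma map_perm {μ : Measure (Site → ℝ)} (hμ : IsUniformCoupling μ) (Φ : Site ≃ Site) :
    μ.map (fun ω v => ω (Φ v)) = μ := by
  have := hμ.1
  have h1 := (iIndepFun_iff_map_fun_eq_infinitePi_map
    (fun v : Site => measurable_pi_apply (X := fun _ : Site => ℝ) v)).1 hμ.2.1
  have h2 := (iIndepFun_iff_map_fun_eq_infinitePi_map
    (fun v : Site => measurable_pi_apply (X := fun _ : Site => ℝ) (Φ v))).1
      (hμ.2.1.precomp Φ.injective)
  simp only [hμ.2.2] at h1 h2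
  rw [h2, ← h1]
  exact Measure.map_id

lemma map_flip {μ : Measure (Site → ℝ)} (hμ : IsUniformCoupling μ) :
    μ.map (fun ω v => 1 - ω v) = μ := by
  have := hμ.1
  have h1 := (iIndepFun_iff_map_fun_eq_infinitePi_map
    (fun v : Site => measurable_pi_apply (X := fun _ : Site => ℝ) v)).1 hμ.2.1
  have hm : Measurable (fun x : ℝ => 1 - x) := by fun_prop
  have h2 := (iIndepFun_iff_map_fun_eq_infinitePi_map (P := μ)
    (X := fun (v : Site) (ω : Site → ℝ) => 1 - ω v)
    (fun v : Site => by fun_prop)).1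
      (hμ.2.1.comp (fun _ x => 1 - x) (fun _ => hm))
  have h3 : ∀ v : Site, μ.map (fun ω : Site → ℝ => 1 - ω v) = volume.restrict (Set.Icc (0 : ℝ) 1) := by
    intro v
    have : (fun ω : Site → ℝ => 1 - ω v) = (fun x : ℝ => 1 - x) ∘ (fun ω => ω v) := rfl
    rw [this, ← Measure.map_map hm (measurable_pi_apply v), hμ.2.2 v]
    have hp : MeasurePreserving (fun x : ℝ => 1 - x) volume volume :=
      Measure.measurePreserving_sub_left volume 1
    have := (hp.restrict_preimage (s := Set.Icc (0 : ℝ) 1) measurableSet_Icc).map_eq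
    have hs : (fun x : ℝ => 1 - x) ⁻¹' Set.Icc 0 1 = Set.Icc 0 1 := by
      ext x; simp only [Set.mem_preimage, Set.mem_Icc]; constructor <;> rintro ⟨a, b⟩ <;> constructor <;> linarith
    rw [hs] at this
    exact this
  simp only [hμ.2.2] at h1
  simp only [h3] at h2
  rw [h2, ← h1]
  exact Measure.map_id

lemma EvJ_inv {μ : Measure (Site → ℝ)} (hμ : IsUniformCoupling μ) (Φ : Site ≃ Site)
    (hΦ : ∀ u v, Tri.Adj u v → Tri.Adj (Φ u) (Φ v)) (q : ℝ)
    (D D' : Set Site) (P P' : Site → Site → Prop) (hD : ∀ v ∈ D, Φ v ∈ D')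
    (hP : ∀ u v, u ∈ D → v ∈ D → P u v → P' (Φ u) (Φ v)) :
    μ.real (EvJ q D P) ≤ μ.real (EvJ q D' P') := by
  have := hμ.1
  have hm : Measurable (fun (ω : Site → ℝ) v => ω (Φ v)) := by fun_prop
  have h := map_perm hμ Φ
  have e : μ.real (EvJ q D P) = μ.real ((fun (ω : Site → ℝ) v => ω (Φ v)) ⁻¹' EvJ q D P) := by
    simp only [Measure.real]
    conv_lhs => rw [← h]
    rw [Measure.map_apply hm (meas_EvJ' q D P)]
  rw [e]
  apply measureReal_mono _ (measure_ne_top _ _)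
  rintro ω ⟨u, v, hj, hp⟩
  refine ⟨Φ u, Φ v, hj.map Φ hΦ ?_, hP u v hj.left_mem.1 hj.right_mem.1 hp⟩
  rintro a ⟨ha, hb⟩
  exact ⟨hD a ha, hb⟩



/-! ### Frames, rectangles and the covering lemma -/

/-- three lattice automorphisms. -/
def frame : Fin 3 → Site ≃ Site
  | 0 => Equiv.refl _
  | 1 => Equiv.prodComm _ _
  | 2 => { toFun := fun v => (-v.2, v.1 + v.2)
           invFun := fun v => (v.1 + v.2, -v.1)
           left_inv := fun v => by ext <;> simp
           right_inv := fun v => by ext <;> simp }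

lemma frame_adj (i : Fin 3) (u v : Site) (h : Tri.Adj u v) : Tri.Adj (frame i u) (frame i v) := by
  rw [adj_iff] at h ⊢
  fin_cases i
  · exact h
  · change (u.2 - v.2) ^ 2 + (u.2 - v.2) * (u.1 - v.1) + (u.1 - v.1) ^ 2 = 1
    linarith
  · change (-u.2 - -v.2) ^ 2 + (-u.2 - -v.2) * (u.1 + u.2 - (v.1 + v.2))
      + (u.1 + u.2 - (v.1 + v.2)) ^ 2 = 1
    linarith

/-- longitudinal and transverse coordinates in a frame. -/
def gF (i : Fin 3) (v : Site) : ℤ := fA (frame i v)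
def tF (i : Fin 3) (v : Site) : ℤ := (frame i v).2

lemma gF0 (v : Site) : gF 0 v = fA v := rfl
lemma gF1 (v : Site) : gF 1 v = fC v := by
  change 2 * v.2 + v.1 = v.1 + 2 * v.2; ring
lemma gF2 (v : Site) : gF 2 v = fB v := by
  change 2 * (-v.2) + (v.1 + v.2) = v.1 - v.2; ring
lemma tF0 (v : Site) : tF 0 v = v.2 := rfl
lemma tF1 (v : Site) : tF 1 v = v.1 := rfl
lemma tF2 (v : Site) : tF 2 v = v.1 + v.2 := rfl

lemma lip_gF (i : Fin 3) : Lip (gF i) := fun u v h => lip_A _ _ (frame_adj i u v h)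

/-- the shift. -/
def shiftE (s : Site) : Site ≃ Site := Equiv.subRight s

lemma shift_adj (s u v : Site) (h : Tri.Adj u v) : Tri.Adj (shiftE s u) (shiftE s v) := by
  rw [adj_iff] at h ⊢
  change (u.1 - s.1 - (v.1 - s.1)) ^ 2 + (u.1 - s.1 - (v.1 - s.1)) * (u.2 - s.2 - (v.2 - s.2))
    + (u.2 - s.2 - (v.2 - s.2)) ^ 2 = 1
  simpa using h

/-- the basic rectangle. -/
def Rn (n : ℤ) : Set Site := {v | 0 ≤ fA v ∧ fA v ≤ 2 * n ∧ 0 ≤ 10 * v.2 ∧ 10 * v.2 ≤ 23 * n}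

/-- the basic crossing probability. -/
def fR (μ : Measure (Site → ℝ)) (q : ℝ) (n : ℤ) : ℝ :=
  μ.real (EvJ q (Rn n) (fun u v => fA u ≤ 2 ∧ 2 * n - 2 ≤ fA v))

lemma fR_nonneg (μ : Measure (Site → ℝ)) (q : ℝ) (n : ℤ) : 0 ≤ fR μ q n := measureReal_nonneg

lemma rect_le {μ : Measure (Site → ℝ)} (hμ : IsUniformCoupling μ) (q : ℝ) (i : Fin 3)
    (n g t s : ℤ) (hs : g = 2 * s + t) (D : Set Site) (P : Site → Site → Prop)
    (hD : ∀ v ∈ D, g ≤ gF i v ∧ gF i v ≤ g + 2 * n ∧ 10 * t ≤ 10 * tF i v ∧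
      10 * tF i v ≤ 10 * t + 23 * n)
    (hP : ∀ u v, u ∈ D → v ∈ D → P u v → gF i u ≤ g + 2 ∧ g + 2 * n - 2 ≤ gF i v) :
    μ.real (EvJ q D P) ≤ fR μ q n := by
  have key : ∀ v, fA (shiftE (s, t) (frame i v)) = gF i v - g ∧
      (shiftE (s, t) (frame i v)).2 = tF i v - t := by
    intro v
    change 2 * ((frame i v).1 - s) + ((frame i v).2 - t) = 2 * (frame i v).1 + (frame i v).2 - g ∧
      (frame i v).2 - t = (frame i v).2 - t
    exact ⟨by rw [hs]; ring, rfl⟩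
  apply EvJ_inv hμ ((frame i).trans (shiftE (s, t)))
  · intro u v h
    exact shift_adj _ _ _ (frame_adj i _ _ h)
  · intro v hv
    have h := hD v hv
    have k := key v
    change 0 ≤ fA (shiftE (s, t) (frame i v)) ∧ fA (shiftE (s, t) (frame i v)) ≤ 2 * n ∧
      0 ≤ 10 * (shiftE (s, t) (frame i v)).2 ∧ 10 * (shiftE (s, t) (frame i v)).2 ≤ 23 * n
    rw [k.1, k.2]
    omega
  · intro u v hu hv h
    have h := hP u v hu hv h
    have k := key v
    have k' := key u
    change fA (shiftE (s, t) (frame i u)) ≤ 2 ∧ 2 * n - 2 ≤ fA (shiftE (s, t) (frame i v))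
    rw [k.1, k'.1]
    omega

lemma ceil_mult (g m : ℤ) (hm : 0 < m) : ∃ j : ℤ, g ≤ m * j ∧ m * j < g + m := by
  refine ⟨-((-g) / m), ?_⟩
  have h1 := Int.emod_add_mul_ediv (-g) m
  have h2 := Int.emod_nonneg (-g) hm.ne'
  have h3 := Int.emod_lt_of_pos (-g) hm
  constructor <;> linarith

lemma floor_mult (g m : ℤ) (hm : 0 < m) : ∃ j : ℤ, m * j ≤ g ∧ g < m * j + m := by
  refine ⟨g / m, ?_⟩
  have h1 := Int.emod_add_mul_ediv g m
  have h2 := Int.emod_nonneg g hm.ne'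
  have h3 := Int.emod_lt_of_pos g hm
  constructor <;> linarith

/-- the sub-rectangle of the covering. -/
def Win (ν : ℤ) (f : Fin 3) (j k : ℤ) : Set Site :=
  {x | 8 * ν * j ≤ gF f x ∧ gF f x ≤ 8 * ν * j + 16 * ν ∧ 10 * (2 * ν * k) ≤ 10 * tF f x ∧
    10 * tF f x ≤ 10 * (2 * ν * k) + 184 * ν}

lemma mul_lt_cancel {ν a b : ℤ} (hν : 1 ≤ ν) (h : ν * a < ν * b) : a < b :=
  lt_of_mul_lt_mul_left h (by omega)

lemma cover {E : Set Site} {u v : Site} {ν H i : ℤ} (hν : 1 ≤ ν) (h : J E u v)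
    (hE : ∀ x ∈ E, 8 * ν * i ≤ fA x ∧ fA x ≤ 8 * ν * i + 16 * ν ∧ -(8 * ν * H) ≤ x.2 ∧
      x.2 ≤ 8 * ν * H)
    (hi : -H ≤ i ∧ i ≤ H) (hu : fA u ≤ 8 * ν * i + 2) (hv : 8 * ν * i + 16 * ν - 2 ≤ fA v) :
    ∃ f : Fin 3, ∃ j k : ℤ, (-(6 * H + 8) ≤ j ∧ j ≤ 6 * H + 8) ∧
      (-(6 * H + 8) ≤ k ∧ k ≤ 6 * H + 8) ∧ ∃ u' v', J (E ∩ Win ν f j k) u' v' ∧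
      gF f u' ≤ 8 * ν * j + 2 ∧ 8 * ν * j + 16 * ν - 2 ≤ gF f v' := by
  have hH : 0 ≤ H := by omega
  have hiν1 : -(ν * H) ≤ ν * i := by nlinarith
  have hiν2 : ν * i ≤ ν * H := by nlinarith
  by_cases hc : ∃ x1 x2, J E u x1 ∧ J E u x2 ∧ x1.2 + 16 * ν ≤ x2.2
  · obtain ⟨x1, x2, h1, h2, h12⟩ := hc
    -- common argument
    have main : ∀ (f : Fin 3) (z1 z2 : Site), J E z1 z2 → gF f z1 + 24 * ν ≤ gF f z2 →
        (∀ x, 3 * tF f x = 2 * fA x - gF f x) →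
        (∀ x ∈ E, -(16 * ν * H) ≤ gF f x ∧ gF f x ≤ 16 * ν * H + 8 * ν) →
        ∃ j k : ℤ, (-(6 * H + 8) ≤ j ∧ j ≤ 6 * H + 8) ∧
      (-(6 * H + 8) ≤ k ∧ k ≤ 6 * H + 8) ∧ ∃ u' v', J (E ∩ Win ν f j k) u' v' ∧
      gF f u' ≤ 8 * ν * j + 2 ∧ 8 * ν * j + 16 * ν - 2 ≤ gF f v' := by
      intro f z1 z2 hz hg ht hb
      obtain ⟨j, hj1, hj2⟩ := ceil_mult (gF f z1) (8 * ν) (by omega)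
      obtain ⟨k, hk1, hk2⟩ := floor_mult (4 * (2 * i - j - 2)) 3 (by omega)
      have b1 := hb z1 hz.left_mem
      have jl : j < 2 * H + 2 := by
        apply mul_lt_cancel hν; linarith
      have jg : -(2 * H) - 1 < j := by
        apply mul_lt_cancel hν; linarith
      refine ⟨j, k, by omega, by omega, ?_⟩
      obtain ⟨u', v', hJ, hu', hv'⟩ := hz.slab (lip_gF f) (c := 8 * ν * j) (w := 16 * ν)
        (by omega) (by omega) (by omega)
      refine ⟨u', v', hJ.mono ?_, hu', hv'⟩
      rintro x ⟨hxE, hx1, hx2⟩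
      refine ⟨hxE, hx1, hx2, ?_, ?_⟩
      · have e1 := (hE x hxE)
        have t := ht x
        have hk : ν * (3 * k) ≤ ν * (4 * (2 * i - j - 2)) :=
          mul_le_mul_of_nonneg_left hk1 (by omega)
        linarith
      · have e1 := (hE x hxE)
        have t := ht x
        have hk : ν * (4 * (2 * i - j - 2)) ≤ ν * (3 * k + 2) :=
          mul_le_mul_of_nonneg_left (by omega) (by omega)
        linarith
    have b1 := hE x1 h1.right_mem
    have b2 := hE x2 h2.right_mem
    by_cases hA : fA x1 ≤ fA x2
    · refine ⟨1, main 1 x1 x2 (h1.symm.trans h2) ?_ ?_ ?_⟩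
      · rw [gF1, gF1]; simp only [fA, fC] at *; omega
      · intro x; rw [gF1, tF1]; simp only [fA, fC]; ring
      · intro x hx
        have := hE x hx
        rw [gF1]; simp only [fA, fC] at *
        constructor <;> linarith
    · refine ⟨2, main 2 x2 x1 (h2.symm.trans h1) ?_ ?_ ?_⟩
      · rw [gF2, gF2]; simp only [fA, fB] at *; omega
      · intro x; rw [gF2, tF2]; simp only [fA, fB]; ring
      · intro x hx
        have := hE x hx
        rw [gF2]; simp only [fA, fB] at *
        constructor <;> linarith
  · push Not at hc
    obtain ⟨m, ⟨x0, hx0, hm⟩, hmin⟩ := Int.exists_least_of_bdd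
      (P := fun z => ∃ x, J E u x ∧ x.2 = z)
      ⟨-(8 * ν * H), fun z ⟨x, hx, hz⟩ => hz ▸ (hE x hx.right_mem).2.2.1⟩
      ⟨u.2, u, .refl h.left_mem, rfl⟩
    obtain ⟨k, hk1, hk2⟩ := floor_mult m (2 * ν) (by omega)
    have b0 := hE x0 hx0.right_mem
    have kl : k < 4 * H + 1 := by
      apply mul_lt_cancel hν; linarith
    have kg : -(4 * H) - 1 < k := by
      apply mul_lt_cancel hν; linarith
    refine ⟨0, i, k, by omega, by omega, u, v, h.comp.mono ?_, hu, hv⟩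
    rintro x ⟨hxE, hx⟩
    have e := hE x hxE
    have := hc x0 x hx0 hx
    have := hmin x.2 ⟨x, hx, rfl⟩
    refine ⟨hxE, e.1, e.2.1, ?_, ?_⟩ <;> rw [tF0] <;> linarith

/-- the covering constant. -/
def Mc (H : ℤ) : ℝ := 3 * (2 * (6 * H + 8) + 1) ^ 2

lemma union_le {μ : Measure (Site → ℝ)} (hμ : IsUniformCoupling μ) {ι : Type*} (s : Finset ι)
    (F : ι → Set (Site → ℝ)) (E : Set (Site → ℝ)) (hE : ∀ ω ∈ E, ∃ i ∈ s, ω ∈ F i) (c : ℝ)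
    (hc : ∀ i ∈ s, μ.real (F i) ≤ c) : μ.real E ≤ s.card * c := by
  have := hμ.1
  have h1 : E ⊆ ⋃ i ∈ s, F i := by
    intro ω hω
    obtain ⟨i, hi, h⟩ := hE ω hω
    exact Set.mem_biUnion hi h
  calc μ.real E ≤ μ.real (⋃ i ∈ s, F i) := measureReal_mono h1 (measure_ne_top _ _)
    _ ≤ ∑ i ∈ s, μ.real (F i) := measureReal_biUnion_finset_le _ _
    _ ≤ ∑ i ∈ s, c := Finset.sum_le_sum hc
    _ = s.card * c := by rw [Finset.sum_const, nsmul_eq_mul]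

lemma slab_prob {μ : Measure (Site → ℝ)} (hμ : IsUniformCoupling μ) (q : ℝ) {ν H i : ℤ}
    (hν : 1 ≤ ν) (hi : -H ≤ i ∧ i ≤ H) (D : Set Site) (P : Site → Site → Prop)
    (hD : ∀ x ∈ D, 8 * ν * i ≤ fA x ∧ fA x ≤ 8 * ν * i + 16 * ν ∧ -(8 * ν * H) ≤ x.2 ∧
      x.2 ≤ 8 * ν * H)
    (hP : ∀ u v, u ∈ D → v ∈ D → P u v → fA u ≤ 8 * ν * i + 2 ∧ 8 * ν * i + 16 * ν - 2 ≤ fA v) :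
    μ.real (EvJ q D P) ≤ Mc H * fR μ q (8 * ν) := by
  have h := union_le hμ
    ((Finset.univ : Finset (Fin 3)) ×ˢ (Finset.Icc (-(6 * H + 8)) (6 * H + 8) ×ˢ
      Finset.Icc (-(6 * H + 8)) (6 * H + 8)))
    (fun a => EvJ q (D ∩ Win ν a.1 a.2.1 a.2.2) (fun u v => gF a.1 u ≤ 8 * ν * a.2.1 + 2 ∧
      8 * ν * a.2.1 + 16 * ν - 2 ≤ gF a.1 v)) (EvJ q D P) ?_ (fR μ q (8 * ν)) ?_
  · refine h.trans (le_of_eq ?_)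
    congr 1
    rw [Finset.card_product, Finset.card_product, Int.card_Icc, Finset.card_univ, Fintype.card_fin]
    have : ((6 * H + 8 + 1 - -(6 * H + 8)).toNat : ℝ) = 2 * (6 * H + 8) + 1 := by
      have : ((6 * H + 8 + 1 - -(6 * H + 8)).toNat : ℤ) = 2 * (6 * H + 8) + 1 := by
        rw [Int.toNat_of_nonneg (by omega)]; ring
      exact_mod_cast this
    push_cast
    rw [this]
    unfold Mc
    ring
  · rintro ω ⟨u, v, hj, hp⟩
    have hp' := hP u v hj.left_mem.1 hj.right_mem.1 hp
    obtain ⟨f, j, k, hj1, hk1, u', v', hJ, h1, h2⟩ :=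
      cover hν hj (fun x hx => hD x hx.1) hi hp'.1 hp'.2
    refine ⟨(f, j, k), ?_, u', v', hJ.mono ?_, h1, h2⟩
    · simp only [Finset.mem_product, Finset.mem_univ, Finset.mem_Icc, true_and]
      exact ⟨hj1, hk1⟩
    · rintro x ⟨⟨a, b⟩, c⟩
      exact ⟨⟨a, c⟩, b⟩
  · rintro ⟨f, j, k⟩ -
    refine rect_le hμ q f (8 * ν) (8 * ν * j) (2 * ν * k) (4 * ν * j - ν * k) (by ring) _ _ ?_ ?_
    · rintro v ⟨-, h1, h2, h3, h4⟩
      exact ⟨h1, by linarith, h3, by linarith⟩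
    · rintro u v - - ⟨h1, h2⟩
      exact ⟨h1, by linarith⟩


/-! ### Doubling the scale -/

lemma dyadic {μ : Measure (Site → ℝ)} (hμ : IsUniformCoupling μ) (q : ℝ) {ν : ℤ} (hν : 1 ≤ ν) :
    fR μ q (8 * (2 * ν)) ≤ (Mc 5 * fR μ q (8 * ν)) ^ 2 := by
  have := hμ.1
  set D1 : Set Site := Rn (8 * (2 * ν)) ∩ {x | fA x ≤ 16 * ν - 1} with hD1
  set D2 : Set Site := Rn (8 * (2 * ν)) ∩ {x | 16 * ν ≤ fA x ∧ fA x ≤ 16 * ν + 16 * ν} with hD2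
  set P1 : Site → Site → Prop := fun u v => fA u ≤ 2 ∧ 16 * ν - 2 ≤ fA v
  set P2 : Site → Site → Prop := fun u v => fA u ≤ 16 * ν + 2 ∧ 16 * ν + 16 * ν - 2 ≤ fA v
  have hsub : EvJ q (Rn (8 * (2 * ν))) (fun u v => fA u ≤ 2 ∧ 2 * (8 * (2 * ν)) - 2 ≤ fA v) ⊆
      EvJ q D1 P1 ∩ EvJ q D2 P2 := by
    rintro ω ⟨u, v, hj, hu, hv⟩
    constructor
    · obtain ⟨w, w', h1, h2, h3, h4⟩ := hj.first_exit (E := {x | fA x ≤ 16 * ν - 1})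
        (show fA u ≤ 16 * ν - 1 by omega) (show ¬ (fA v ≤ 16 * ν - 1) by omega)
      refine ⟨u, w, h1.mono ?_, hu, ?_⟩
      · rintro x ⟨⟨a, b⟩, c⟩
        exact ⟨⟨a, c⟩, b⟩
      · have hl := abs_le.1 (lip_A w w' h2)
        have : ¬ (fA w' ≤ 16 * ν - 1) := h4
        omega
    · obtain ⟨u', v', h1, h2, h3⟩ := hj.slab lip_A (c := 16 * ν) (w := 16 * ν) (by omega) (by omega)
        (by omega)
      refine ⟨u', v', h1.mono ?_, h2, h3⟩
      rintro x ⟨⟨a, b⟩, c⟩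
      exact ⟨⟨a, c⟩, b⟩
  have hdis : Disjoint D1 D2 := by
    rw [Set.disjoint_left]
    rintro x ⟨-, h1⟩ ⟨-, h2, -⟩
    have h1 : fA x ≤ 16 * ν - 1 := h1
    omega
  have e1 : μ.real (EvJ q D1 P1) ≤ Mc 5 * fR μ q (8 * ν) := by
    refine slab_prob hμ q (H := 5) (i := 0) hν (by omega) D1 P1 ?_ ?_
    · rintro x ⟨⟨h1, h2, h3, h4⟩, h5⟩
      have h5 : fA x ≤ 16 * ν - 1 := h5
      omega
    · rintro u v - - ⟨h1, h2⟩
      omega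
  have e2 : μ.real (EvJ q D2 P2) ≤ Mc 5 * fR μ q (8 * ν) := by
    refine slab_prob hμ q (H := 5) (i := 2) hν (by omega) D2 P2 ?_ ?_
    · rintro x ⟨⟨h1, h2, h3, h4⟩, h5, h6⟩
      omega
    · rintro u v - - ⟨h1, h2⟩
      omega
  calc fR μ q (8 * (2 * ν)) ≤ μ.real (EvJ q D1 P1 ∩ EvJ q D2 P2) :=
        measureReal_mono hsub (measure_ne_top _ _)
    _ = μ.real (EvJ q D1 P1) * μ.real (EvJ q D2 P2) :=
        indep_disj hμ hdis (meas_EvJ _ _ _) (meas_EvJ _ _ _)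
    _ ≤ (Mc 5 * fR μ q (8 * ν)) * (Mc 5 * fR μ q (8 * ν)) :=
        mul_le_mul e1 e2 measureReal_nonneg (measureReal_nonneg.trans e1)
    _ = _ := by ring

lemma dyadic_iter {μ : Measure (Site → ℝ)} (hμ : IsUniformCoupling μ) (q : ℝ) {ν : ℤ} (hν : 1 ≤ ν)
    (h0 : Mc 5 ^ 2 * fR μ q (8 * ν) ≤ Real.exp (-1)) (k : ℕ) :
    Mc 5 ^ 2 * fR μ q (8 * (2 ^ k * ν)) ≤ Real.exp (-2 ^ k) := by
  induction k with
  | zero => simpa using h0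
  | succ k ih =>
    have hk : 1 ≤ 2 ^ k * ν := one_le_mul_of_one_le_of_one_le (one_le_pow₀ (by norm_num)) hν
    have h1 := dyadic hμ q hk
    have e : (2 : ℤ) ^ (k + 1) * ν = 2 * (2 ^ k * ν) := by ring
    rw [e]
    have hM : 0 ≤ Mc 5 ^ 2 := sq_nonneg _
    calc Mc 5 ^ 2 * fR μ q (8 * (2 * (2 ^ k * ν)))
        ≤ Mc 5 ^ 2 * (Mc 5 * fR μ q (8 * (2 ^ k * ν))) ^ 2 := mul_le_mul_of_nonneg_left h1 hM
      _ = (Mc 5 ^ 2 * fR μ q (8 * (2 ^ k * ν))) ^ 2 := by ring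
      _ ≤ (Real.exp (-2 ^ k)) ^ 2 :=
          pow_le_pow_left₀ (mul_nonneg hM (fR_nonneg _ _ _)) ih 2
      _ = Real.exp (-2 ^ (k + 1)) := by
          rw [← Real.exp_nat_mul]; congr 1; push_cast; ring


/-! ### The multi-scale argument in a half plane -/

def Gs (e : ℤ) : Set Site := {x | 0 ≤ fA x ∧ fA x ≤ 2930 * e ∧ fB x ≤ 2485 * e ∧ fC x ≤ 2485 * e}
def Ts (e : ℤ) : Set Site := {x | fA x < 98 * e ∧ fB x < 85 * e ∧ fC x < 85 * e}

def YA (q : ℝ) (e : ℤ) : Set (Site → ℝ) :=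
  EvJ q (Gs e ∩ {x | 98 * e ≤ fA x}) (fun u v => fA u ≤ 98 * e + 2 ∧ 2930 * e - 2 ≤ fA v)
def YB (q : ℝ) (e : ℤ) : Set (Site → ℝ) :=
  EvJ q (Gs e ∩ {x | 85 * e ≤ fB x}) (fun u v => fB u ≤ 85 * e + 2 ∧ 2485 * e - 2 ≤ fB v)
def YC (q : ℝ) (e : ℤ) : Set (Site → ℝ) :=
  EvJ q (Gs e ∩ {x | 85 * e ≤ fC x}) (fun u v => fC u ≤ 85 * e + 2 ∧ 2485 * e - 2 ≤ fC v)
def Ys (q : ℝ) (e : ℤ) : Set (Site → ℝ) := YA q e ∪ (YB q e ∪ YC q e)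

lemma meas_Ys (q : ℝ) (e : ℤ) : MeasurableSet[mD (Gs e ∩ (Ts e)ᶜ)] (Ys q e) := by
  refine MeasurableSet.union (mD_mono ?_ _ (meas_EvJ _ _ _))
    (MeasurableSet.union (mD_mono ?_ _ (meas_EvJ _ _ _)) (mD_mono ?_ _ (meas_EvJ _ _ _)))
  · rintro x ⟨h, h1⟩
    refine ⟨h, fun h2 => ?_⟩
    have h1 : 98 * e ≤ fA x := h1
    have := h2.1
    omega
  · rintro x ⟨h, h1⟩
    refine ⟨h, fun h2 => ?_⟩
    have h1 : 85 * e ≤ fB x := h1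
    have := h2.2.1
    omega
  · rintro x ⟨h, h1⟩
    refine ⟨h, fun h2 => ?_⟩
    have h1 : 85 * e ≤ fC x := h1
    have := h2.2.2
    omega

lemma Ys_le {μ : Measure (Site → ℝ)} (hμ : IsUniformCoupling μ) {q : ℝ} {e : ℤ} (he : 1 ≤ e)
    (h : ∀ n : ℤ, e ≤ n → fR μ q n ≤ 1 / 100) : μ.real (Ys q e) ≤ 3 / 100 := by
  have := hμ.1
  have hA : μ.real (YA q e) ≤ 1 / 100 := by
    refine (rect_le hμ q 0 (1416 * e) (98 * e) (-1624 * e) (861 * e) (by ring) _ _ ?_ ?_).trans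
      (h _ (by omega))
    · rintro x ⟨⟨h1, h2, h3, h4⟩, h5⟩
      have h5 : 98 * e ≤ fA x := h5
      rw [gF0, tF0]
      simp only [fA, fB, fC] at *
      omega
    · rintro u v - - ⟨h1, h2⟩
      rw [gF0, gF0]
      omega
  have hB : μ.real (YB q e) ≤ 1 / 100 := by
    refine (rect_le hμ q 2 (1200 * e) (85 * e) (-829 * e) (457 * e) (by ring) _ _ ?_ ?_).trans
      (h _ (by omega))
    · rintro x ⟨⟨h1, h2, h3, h4⟩, h5⟩
      have h5 : 85 * e ≤ fB x := h5
      rw [gF2, tF2]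
      simp only [fA, fB, fC] at *
      omega
    · rintro u v - - ⟨h1, h2⟩
      rw [gF2, gF2]
      omega
  have hC : μ.real (YC q e) ≤ 1 / 100 := by
    refine (rect_le hμ q 1 (1200 * e) (85 * e) (-829 * e) (457 * e) (by ring) _ _ ?_ ?_).trans
      (h _ (by omega))
    · rintro x ⟨⟨h1, h2, h3, h4⟩, h5⟩
      have h5 : 85 * e ≤ fC x := h5
      rw [gF1, tF1]
      simp only [fA, fB, fC] at *
      omega
    · rintro u v - - ⟨h1, h2⟩
      rw [gF1, gF1]
      omega
  have h1 : μ.real (Ys q e) ≤ μ.real (YA q e) + μ.real (YB q e ∪ YC q e) := measureReal_union_le _ _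
  have h2 : μ.real (YB q e ∪ YC q e) ≤ μ.real (YB q e) + μ.real (YC q e) := measureReal_union_le _ _
  linarith

lemma exit_Ys {q : ℝ} {e : ℤ} (he : 1 ≤ e) {ω : Site → ℝ} {u v : Site}
    (hj : J ({x | 0 ≤ fA x} ∩ Bl q ω) u v) (hu : fA u ≤ 2) (huB : fB u ≤ 85 * e + 2)
    (huC : fC u ≤ 85 * e + 2) (hv : 2930 * e < fA v) : ω ∈ Ys q e := by
  have hu0 : 0 ≤ fA u := hj.left_mem.1
  obtain ⟨w, w', h1, h2, h3, h4⟩ := hj.first_exit (E := Gs e) ⟨hu0, by omega, by omega, by omega⟩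
    (fun h => by have := h.2.1; omega)
  have hA := abs_le.1 (lip_A w w' h2)
  have hB := abs_le.1 (lip_B w w' h2)
  have hC := abs_le.1 (lip_C w w' h2)
  have h0 : 0 ≤ fA w' := h3.1
  have h4' : ¬ (0 ≤ fA w' ∧ fA w' ≤ 2930 * e ∧ fB w' ≤ 2485 * e ∧ fC w' ≤ 2485 * e) := h4
  have hcase : 2930 * e < fA w' ∨ 2485 * e < fB w' ∨ 2485 * e < fC w' := by omega
  rcases hcase with hc | hc | hc
  · obtain ⟨u', v', g1, g2, g3⟩ := h1.slab lip_A (c := 98 * e) (w := 2832 * e) (by omega) (by omega)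
      (by omega)
    refine Or.inl ⟨u', v', g1.mono ?_, g2, by omega⟩
    rintro x ⟨⟨⟨a, b⟩, c⟩, d, -⟩
    exact ⟨⟨c, d⟩, b⟩
  · obtain ⟨u', v', g1, g2, g3⟩ := h1.slab lip_B (c := 85 * e) (w := 2400 * e) (by omega) (by omega)
      (by omega)
    refine Or.inr (Or.inl ⟨u', v', g1.mono ?_, g2, by omega⟩)
    rintro x ⟨⟨⟨a, b⟩, c⟩, d, -⟩
    exact ⟨⟨c, d⟩, b⟩
  · obtain ⟨u', v', g1, g2, g3⟩ := h1.slab lip_C (c := 85 * e) (w := 2400 * e) (by omega) (by omega)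
      (by omega)
    refine Or.inr (Or.inr ⟨u', v', g1.mono ?_, g2, by omega⟩)
    rintro x ⟨⟨⟨a, b⟩, c⟩, d, -⟩
    exact ⟨⟨c, d⟩, b⟩

/-- all the scales `30 ^ j * e`, `j < n`, are crossed. -/
def Ws (q : ℝ) (e : ℤ) : ℕ → Set (Site → ℝ)
  | 0 => Set.univ
  | n + 1 => Ws q e n ∩ Ys q (30 ^ n * e)

lemma meas_Ws (q : ℝ) {e : ℤ} (he : 1 ≤ e) (n : ℕ) :
    MeasurableSet[mD (Ts (30 ^ n * e))] (Ws q e n) := by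
  induction n with
  | zero => exact @MeasurableSet.univ _ (mD _)
  | succ n ih =>
    have hp : 1 ≤ 30 ^ n * e := one_le_mul_of_one_le_of_one_le (one_le_pow₀ (by norm_num)) he
    have e1 : (30 : ℤ) ^ (n + 1) * e = 30 * (30 ^ n * e) := by ring
    rw [e1]
    refine MeasurableSet.inter (mD_mono ?_ _ ih) (mD_mono ?_ _ (meas_Ys q _))
    · rintro x ⟨h1, h2, h3⟩
      exact ⟨by omega, by omega, by omega⟩
    · rintro x ⟨⟨h0, h1, h2, h3⟩, -⟩
      exact ⟨by omega, by omega, by omega⟩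

lemma Ws_le {μ : Measure (Site → ℝ)} (hμ : IsUniformCoupling μ) {q : ℝ} {e : ℤ} (he : 1 ≤ e)
    (h : ∀ n : ℤ, e ≤ n → fR μ q n ≤ 1 / 100) (n : ℕ) : μ.real (Ws q e n) ≤ (3 / 100) ^ n := by
  have := hμ.1
  induction n with
  | zero => exact (measureReal_le_one).trans (by simp)
  | succ n ih =>
    have hp1 : (1 : ℤ) ≤ 30 ^ n := one_le_pow₀ (by norm_num)
    have hp : 1 ≤ 30 ^ n * e := one_le_mul_of_one_le_of_one_le hp1 he
    have hp2 : e ≤ 30 ^ n * e := by nlinarith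
    have hd : Disjoint (Ts (30 ^ n * e)) (Gs (30 ^ n * e) ∩ (Ts (30 ^ n * e))ᶜ) :=
      Set.disjoint_left.2 fun x h1 h2 => h2.2 h1
    have h1 := indep_disj hμ hd (meas_Ws q he n) (meas_Ys q _)
    have h2 := Ys_le hμ hp (fun m hm => h m (by omega))
    rw [Ws, h1, pow_succ]
    exact mul_le_mul ih h2 measureReal_nonneg (by positivity)

lemma half_sub {q : ℝ} {e : ℤ} (he : 1 ≤ e) {N : ℕ} {ω : Site → ℝ} {u v : Site}
    (hj : J ({x | 0 ≤ fA x} ∩ Bl q ω) u v) (hu : fA u ≤ 2) (hy : 0 ≤ u.2) (hy' : u.2 ≤ 50 * e)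
    (hv : 100 * (30 ^ N * e) - 2 ≤ fA v) : ∀ n ≤ N, ω ∈ Ws q e n := by
  intro n
  induction n with
  | zero => intro _; trivial
  | succ n ih =>
    intro hn
    refine ⟨ih (by omega), ?_⟩
    have hp1 : (1 : ℤ) ≤ 30 ^ n := one_le_pow₀ (by norm_num)
    have hp : 1 ≤ 30 ^ n * e := one_le_mul_of_one_le_of_one_le hp1 he
    have hp2 : e ≤ 30 ^ n * e := by nlinarith
    have hp3 : 30 * (30 ^ n * e) ≤ 30 ^ N * e := by
      have : (30 : ℤ) ^ (n + 1) ≤ 30 ^ N := pow_le_pow_right₀ (by norm_num) hn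
      calc 30 * (30 ^ n * e) = 30 ^ (n + 1) * e := by ring
        _ ≤ _ := mul_le_mul_of_nonneg_right this (by omega)
    generalize (30 : ℤ) ^ n * e = d at *
    generalize (30 : ℤ) ^ N * e = d' at *
    refine exit_Ys hp hj hu ?_ ?_ (by omega)
    · simp only [fA, fB] at *; omega
    · simp only [fA, fC] at *; omega

lemma multi {μ : Measure (Site → ℝ)} (hμ : IsUniformCoupling μ) {q : ℝ} {e : ℤ} (he : 1 ≤ e)
    (h : ∀ n : ℤ, e ≤ n → fR μ q n ≤ 1 / 100) (N : ℕ) :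
    fR μ q (50 * (30 ^ N * e)) ≤ 3 * (9 / 10) ^ N := by
  have := hμ.1
  have hP : 0 ≤ (30 : ℤ) ^ N := by positivity
  have h1 := union_le hμ (Finset.Ico (0 : ℤ) (3 * 30 ^ N))
    (fun t => EvJ q (Rn (50 * (30 ^ N * e))) (fun u v => (fA u ≤ 2 ∧
      2 * (50 * (30 ^ N * e)) - 2 ≤ fA v) ∧ 50 * e * t ≤ u.2 ∧ u.2 ≤ 50 * e * t + 50 * e))
    (EvJ q (Rn (50 * (30 ^ N * e))) (fun u v => fA u ≤ 2 ∧ 2 * (50 * (30 ^ N * e)) - 2 ≤ fA v))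
    ?_ ((3 / 100) ^ N) ?_
  · refine h1.trans (le_of_eq ?_)
    rw [Int.card_Ico]
    have : ((3 * 30 ^ N - 0 : ℤ).toNat : ℝ) = 3 * 30 ^ N := by
      have : ((3 * 30 ^ N - 0 : ℤ).toNat : ℤ) = 3 * 30 ^ N := by
        rw [Int.toNat_of_nonneg (by omega)]; ring
      exact_mod_cast this
    rw [this, mul_assoc, ← mul_pow]
    norm_num
  · rintro ω ⟨u, v, hj, hu, hv⟩
    obtain ⟨t, ht1, ht2⟩ := floor_mult u.2 (50 * e) (by omega)
    obtain ⟨-, -, hy1, hy2⟩ := hj.left_mem.1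
    refine ⟨t, ?_, u, v, hj, ⟨hu, hv⟩, ht1, ht2.le⟩
    rw [Finset.mem_Ico]
    constructor
    · have : -1 < t := by apply mul_lt_cancel he; linarith
      omega
    · apply mul_lt_cancel he
      have : 1 ≤ 30 ^ N * e := one_le_mul_of_one_le_of_one_le (one_le_pow₀ (by norm_num)) he
      linarith
  · intro t _
    refine (EvJ_inv hμ (shiftE (-(25 * e * t), 50 * e * t)) (shift_adj _) q _ {x | 0 ≤ fA x} _
      (fun u v => (fA u ≤ 2 ∧ 100 * (30 ^ N * e) - 2 ≤ fA v) ∧ 0 ≤ u.2 ∧ u.2 ≤ 50 * e)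
      ?_ ?_).trans ((measureReal_mono ?_ (measure_ne_top _ _)).trans (Ws_le hμ he h N))
    · rintro x ⟨h0, -⟩
      change 0 ≤ 2 * (x.1 - -(25 * e * t)) + (x.2 - 50 * e * t)
      simp only [fA] at h0
      linarith
    · rintro u v - - ⟨⟨h1, h2⟩, h3, h4⟩
      change (2 * (u.1 - -(25 * e * t)) + (u.2 - 50 * e * t) ≤ 2 ∧ 100 * (30 ^ N * e) - 2 ≤
        2 * (v.1 - -(25 * e * t)) + (v.2 - 50 * e * t)) ∧ 0 ≤ u.2 - 50 * e * t ∧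
        u.2 - 50 * e * t ≤ 50 * e
      simp only [fA] at h1 h2
      refine ⟨⟨?_, ?_⟩, ?_, ?_⟩ <;> linarith
    · rintro ω ⟨u, v, hj, ⟨h1, h2⟩, h3, h4⟩
      exact half_sub he hj h1 h3 h4 h2 N le_rfl


/-! ### Connections over a long distance in a bounded region -/

lemma big_A {μ : Measure (Site → ℝ)} (hμ : IsUniformCoupling μ) (q : ℝ) {ν H : ℤ} (hν : 1 ≤ ν)
    (hH : 1 ≤ H) :
    μ.real (EvJ q {x | -(8 * ν * H) ≤ fA x ∧ fA x ≤ 8 * ν * H ∧ -(8 * ν * H) ≤ x.2 ∧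
      x.2 ≤ 8 * ν * H} (fun u v => fA u + 24 * ν ≤ fA v)) ≤
    (2 * H + 1) * (Mc H * fR μ q (8 * ν)) := by
  set D : Set Site := {x | -(8 * ν * H) ≤ fA x ∧ fA x ≤ 8 * ν * H ∧ -(8 * ν * H) ≤ x.2 ∧
      x.2 ≤ 8 * ν * H} with hD
  have h1 := union_le hμ (Finset.Icc (-H) H)
    (fun i => EvJ q (D ∩ {x | 8 * ν * i ≤ fA x ∧ fA x ≤ 8 * ν * i + 16 * ν})
      (fun u v => fA u ≤ 8 * ν * i + 2 ∧ 8 * ν * i + 16 * ν - 2 ≤ fA v))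
    (EvJ q D (fun u v => fA u + 24 * ν ≤ fA v)) ?_ (Mc H * fR μ q (8 * ν)) ?_
  · refine h1.trans (le_of_eq ?_)
    rw [Int.card_Icc]
    have : ((H + 1 - -H).toNat : ℝ) = 2 * H + 1 := by
      have : ((H + 1 - -H).toNat : ℤ) = 2 * H + 1 := by
        rw [Int.toNat_of_nonneg (by omega)]; ring
      exact_mod_cast this
    rw [this]
  · rintro ω ⟨u, v, hj, hp⟩
    obtain ⟨i, hi1, hi2⟩ := ceil_mult (fA u) (8 * ν) (by omega)
    have hu := hj.left_mem.1
    have hv := hj.right_mem.1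
    obtain ⟨u', v', g1, g2, g3⟩ := hj.slab lip_A (c := 8 * ν * i) (w := 16 * ν) (by omega)
      (by omega) (by omega)
    refine ⟨i, ?_, u', v', g1.mono ?_, g2, g3⟩
    · rw [Finset.mem_Icc]
      have a1 := hu.1
      have a2 := hv.2.1
      constructor
      · have : -H - 1 < i := by apply mul_lt_cancel hν; linarith
        omega
      · have : i < H + 1 := by apply mul_lt_cancel hν; linarith
        omega
    · rintro x ⟨⟨a, b⟩, c⟩
      exact ⟨⟨a, c⟩, b⟩
  · intro i hi
    rw [Finset.mem_Icc] at hi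
    refine slab_prob hμ q hν hi _ _ ?_ ?_
    · rintro x ⟨⟨h1, h2, h3, h4⟩, h5, h6⟩
      exact ⟨h5, h6, h3, h4⟩
    · rintro u v - - h
      exact h

lemma big_ev {μ : Measure (Site → ℝ)} (hμ : IsUniformCoupling μ) (q : ℝ) {ν H : ℤ} (hν : 1 ≤ ν)
    (hH : 1 ≤ H) (z : Site) (D : Set Site)
    (hD : ∀ x ∈ D, |fA x - fA z| ≤ 8 * ν * H ∧ |fB x - fB z| ≤ 8 * ν * H ∧
      |fC x - fC z| ≤ 8 * ν * H) :
    μ.real (EvJ q D (fun u v => ∃ f : Fin 3, gF f u + 24 * ν ≤ gF f v)) ≤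
    3 * ((2 * H + 1) * (Mc H * fR μ q (8 * ν))) := by
  have h1 := union_le hμ (Finset.univ : Finset (Fin 3))
    (fun f => EvJ q D (fun u v => gF f u + 24 * ν ≤ gF f v))
    (EvJ q D (fun u v => ∃ f : Fin 3, gF f u + 24 * ν ≤ gF f v)) ?_
    ((2 * H + 1) * (Mc H * fR μ q (8 * ν))) ?_
  · simpa using h1
  · rintro ω ⟨u, v, hj, f, hf⟩
    exact ⟨f, Finset.mem_univ _, u, v, hj, hf⟩
  · intro f _
    refine (EvJ_inv hμ ((frame f).trans (shiftE (frame f z)))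
      (fun u v h => shift_adj _ _ _ (frame_adj f _ _ h)) q _ _ _ _ ?_ ?_).trans (big_A hμ q hν hH)
    · intro x hx
      obtain ⟨h1, h2, h3⟩ := hD x hx
      rw [abs_le] at h1 h2 h3
      have k1 : fA (shiftE (frame f z) (frame f x)) = gF f x - gF f z := by
        change 2 * ((frame f x).1 - (frame f z).1) + ((frame f x).2 - (frame f z).2) =
          2 * (frame f x).1 + (frame f x).2 - (2 * (frame f z).1 + (frame f z).2)
        ring
      have k2 : (shiftE (frame f z) (frame f x)).2 = tF f x - tF f z := rfl
      change -(8 * ν * H) ≤ fA (shiftE (frame f z) (frame f x)) ∧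
        fA (shiftE (frame f z) (frame f x)) ≤ 8 * ν * H ∧
        -(8 * ν * H) ≤ (shiftE (frame f z) (frame f x)).2 ∧
        (shiftE (frame f z) (frame f x)).2 ≤ 8 * ν * H
      rw [k1, k2]
      generalize 8 * ν * H = K at *
      fin_cases f
      · change -K ≤ fA x - fA z ∧ fA x - fA z ≤ K ∧ -K ≤ x.2 - z.2 ∧ x.2 - z.2 ≤ K
        simp only [fA, fB, fC] at *; omega
      · change -K ≤ gF 1 x - gF 1 z ∧ gF 1 x - gF 1 z ≤ K ∧ -K ≤ x.1 - z.1 ∧ x.1 - z.1 ≤ K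
        rw [gF1, gF1]
        simp only [fA, fB, fC] at *; omega
      · change -K ≤ gF 2 x - gF 2 z ∧ gF 2 x - gF 2 z ≤ K ∧ -K ≤ (x.1 + x.2) - (z.1 + z.2) ∧
          (x.1 + x.2) - (z.1 + z.2) ≤ K
        rw [gF2, gF2]
        simp only [fA, fB, fC] at *; omega
    · intro u v _ _ h
      change 2 * ((frame f u).1 - (frame f z).1) + ((frame f u).2 - (frame f z).2) + 24 * ν ≤
        2 * ((frame f v).1 - (frame f z).1) + ((frame f v).2 - (frame f z).2)
      change 2 * (frame f u).1 + (frame f u).2 + 24 * ν ≤ 2 * (frame f v).1 + (frame f v).2 at h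
      linarith


/-! ### Duality: the outer boundary of a connected set is connected -/

lemma int_sum (f : ℤ → ZMod 2) : ∃ h : ℤ → ZMod 2, ∀ x, h (x + 1) = h x + f x := by
  refine ⟨fun x => ∑ i ∈ Finset.Ico 0 x, f i + ∑ i ∈ Finset.Ico x 0, f i, fun x => ?_⟩
  rcases le_or_gt 0 x with hx | hx
  · have e1 : Finset.Ico 0 (x + 1) = insert x (Finset.Ico 0 x) := by
      ext i; simp only [Finset.mem_Ico, Finset.mem_insert]; omega
    have e2 : Finset.Ico (x + 1) 0 = ∅ := Finset.Ico_eq_empty (by omega)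
    have e3 : Finset.Ico x 0 = ∅ := Finset.Ico_eq_empty (by omega)
    simp only [e1, e2, e3]
    rw [Finset.sum_insert (by simp)]
    simp [add_comm]
  · have e1 : Finset.Ico x 0 = insert x (Finset.Ico (x + 1) 0) := by
      ext i; simp only [Finset.mem_Ico, Finset.mem_insert]; omega
    have e2 : Finset.Ico 0 (x + 1) = ∅ := Finset.Ico_eq_empty (by omega)
    have e3 : Finset.Ico 0 x = ∅ := Finset.Ico_eq_empty (by omega)
    simp only [e1, e2, e3]
    rw [Finset.sum_insert (by simp)]
    have := CharTwo.add_self_eq_zero (f x)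
    simp only [Finset.sum_empty, zero_add]
    linear_combination -this

lemma exact_form (a b d : ℤ → ℤ → ZMod 2) (h1 : ∀ x y, a x y + b x y + d x y = 0)
    (h2 : ∀ x y, d x y + a x (y + 1) + b (x + 1) y = 0) :
    ∃ g : ℤ → ℤ → ZMod 2, ∀ x y, g (x + 1) y = g x y + a x y ∧ g x (y + 1) = g x y + b x y ∧
      g (x + 1) y + g x (y + 1) = d x y := by
  obtain ⟨h, hh⟩ := int_sum (fun x => a x 0)
  choose B hB using fun x => int_sum (b x)
  have c2 : ∀ z : ZMod 2, z + z = 0 := CharTwo.add_self_eq_zero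
  have hv : ∀ x y, (h x + (B x (y + 1) - B x 0)) = (h x + (B x y - B x 0)) + b x y := by
    intro x y; rw [hB]; ring
  have hz : ∀ x y, (h (x + 1) + (B (x + 1) y - B (x + 1) 0)) = (h x + (B x y - B x 0)) + a x y := by
    intro x y
    induction y using Int.induction_on with
    | zero => rw [hh]; ring
    | succ y ih =>
      rw [hv, hv, ih]
      linear_combination h1 x y - h2 x y + c2 (b (x + 1) y) - c2 (b x y)
    | pred y ih =>
      have e1 := hv x (-(y : ℤ) - 1)
      have e2 := hv (x + 1) (-(y : ℤ) - 1)
      have p1 := h1 x (-(y : ℤ) - 1)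
      have p2 := h2 x (-(y : ℤ) - 1)
      rw [sub_add_cancel] at e1 e2 p2
      linear_combination ih - e2 + e1 - p1 + p2 - c2 (b (x + 1) (-(y : ℤ) - 1)) + c2 (b x (-(y : ℤ) - 1))
  refine ⟨fun x y => h x + (B x y - B x 0), fun x y => ⟨hz x y, hv x y, ?_⟩⟩
  simp only []
  rw [hz, hv]
  linear_combination h1 x y + c2 (h x + (B x y - B x 0)) - c2 (d x y)

lemma adj_r (x y : ℤ) : Tri.Adj (x, y) (x + 1, y) := by rw [adj_iff]; ring
lemma adj_u (x y : ℤ) : Tri.Adj (x, y) (x, y + 1) := by rw [adj_iff]; ring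
lemma adj_d (x y : ℤ) : Tri.Adj (x + 1, y) (x, y + 1) := by rw [adj_iff]; ring

lemma exact_tri (c : Site → Site → ZMod 2) (hs : ∀ u v, c u v = c v u)
    (hc : ∀ u v w, Tri.Adj u v → Tri.Adj v w → Tri.Adj u w → c u v + c v w + c u w = 0) :
    ∃ g : Site → ZMod 2, ∀ u v, Tri.Adj u v → g u + g v = c u v := by
  obtain ⟨g, hg⟩ := exact_form (fun x y => c (x, y) (x + 1, y)) (fun x y => c (x, y) (x, y + 1))
    (fun x y => c (x + 1, y) (x, y + 1))
    (fun x y => by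
      have := hc _ _ _ (adj_r x y) (adj_d x y) (adj_u x y)
      linear_combination this)
    (fun x y => by
      have := hc _ _ _ (adj_d x y) (adj_r x (y + 1)) (adj_u (x + 1) y)
      linear_combination this)
  have c2 : ∀ z : ZMod 2, z + z = 0 := CharTwo.add_self_eq_zero
  have key : ∀ x y, g x y + g (x + 1) y = c (x, y) (x + 1, y) ∧
      g x y + g x (y + 1) = c (x, y) (x, y + 1) ∧
      g (x + 1) y + g x (y + 1) = c (x + 1, y) (x, y + 1) := by
    intro x y
    obtain ⟨p1, p2, p3⟩ := hg x y
    refine ⟨?_, ?_, p3⟩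
    · linear_combination p1 + c2 (g x y)
    · linear_combination p2 + c2 (g x y)
  refine ⟨fun v => g v.1 v.2, ?_⟩
  rintro ⟨u1, u2⟩ ⟨v1, v2⟩ h
  have hk := adj_cases h
  simp only [] at hk ⊢
  rcases hk with ⟨e1, e2⟩ | ⟨e1, e2⟩ | ⟨e1, e2⟩ | ⟨e1, e2⟩ | ⟨e1, e2⟩ | ⟨e1, e2⟩
  · obtain rfl : u1 = v1 + 1 := by omega
    obtain rfl : u2 = v2 := by omega
    rw [hs, add_comm]; exact (key _ _).1
  · obtain rfl : v1 = u1 + 1 := by omega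
    obtain rfl : u2 = v2 := by omega
    exact (key _ _).1
  · obtain rfl : u1 = v1 := by omega
    obtain rfl : u2 = v2 + 1 := by omega
    rw [hs, add_comm]; exact (key _ _).2.1
  · obtain rfl : u1 = v1 := by omega
    obtain rfl : v2 = u2 + 1 := by omega
    exact (key _ _).2.1
  · obtain rfl : u1 = v1 + 1 := by omega
    obtain rfl : v2 = u2 + 1 := by omega
    exact (key _ _).2.2
  · obtain rfl : v1 = u1 + 1 := by omega
    obtain rfl : u2 = v2 + 1 := by omega
    rw [hs, add_comm]; exact (key _ _).2.2

/-- the outer boundary. -/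
def oB (C : Set Site) : Set Site := {w | w ∉ C ∧ ∃ a ∈ C, Tri.Adj w a}

open Classical in
lemma tri_case (a b w a' b' w' : Prop) (na : a' → ¬ a) (nb : b' → ¬ b) (nw : w' → ¬ w)
    (x1 : a → b' → ¬ w → w') (x2 : a → w' → ¬ b → b') (x3 : b → a' → ¬ w → w')
    (x4 : b → w' → ¬ a → a') (x5 : w → a' → ¬ b → b') (x6 : w → b' → ¬ a → a') :
    (if (a ∧ b') ∨ (b ∧ a') then (1 : ZMod 2) else 0) + (if (b ∧ w') ∨ (w ∧ b') then 1 else 0) +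
    (if (a ∧ w') ∨ (w ∧ a') then 1 else 0) = 0 := by
  have two : (1 : ZMod 2) + 1 = 0 := rfl
  by_cases a1 : a <;> by_cases b1 : b <;> by_cases w1 : w <;>
    by_cases a2 : a' <;> by_cases b2 : b' <;> by_cases w2 : w' <;>
    simp_all

open Classical in
lemma boundary_conn {C : Set Site} (hC : ∀ a ∈ C, ∀ b ∈ C, J C a b) {u v : Site}
    (hu : u ∈ oB C) (hv : v ∈ oB C) (huv : J Cᶜ u v) : J (oB C) u v := by
  by_contra hnot
  set Γ : Set Site := {w | J (oB C) u w} with hΓ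
  have hΓB : ∀ w ∈ Γ, w ∈ oB C := fun w hw => J.right_mem hw
  have hΓC : ∀ w ∈ Γ, w ∉ C := fun w hw => (hΓB w hw).1
  set c : Site → Site → ZMod 2 := fun a b => if (a ∈ C ∧ b ∈ Γ) ∨ (b ∈ C ∧ a ∈ Γ) then 1 else 0
    with hcdef
  have hext : ∀ a b w, a ∈ C → b ∈ Γ → w ∉ C → Tri.Adj w a → Tri.Adj b w → w ∈ Γ := by
    intro a b w ha hb hw h1 h2
    exact J.step hb h2 ⟨hw, a, ha, h1⟩
  obtain ⟨g, hg⟩ := exact_tri c (fun a b => by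
      simp only [hcdef]; congr 1; exact propext or_comm) (fun a b w hab hbw haw => by
    exact tri_case _ _ _ _ _ _ (hΓC a) (hΓC b) (hΓC w)
      (fun h1 h2 h3 => hext a b w h1 h2 h3 (Tri.adj_symm haw) hbw)
      (fun h1 h2 h3 => hext a w b h1 h2 h3 (Tri.adj_symm hab) (Tri.adj_symm hbw))
      (fun h1 h2 h3 => hext b a w h1 h2 h3 (Tri.adj_symm hbw) haw)
      (fun h1 h2 h3 => hext b w a h1 h2 h3 hab (Tri.adj_symm haw))
      (fun h1 h2 h3 => hext w a b h1 h2 h3 hbw hab)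
      (fun h1 h2 h3 => hext w b a h1 h2 h3 haw (Tri.adj_symm hab)))
  have c2 : ∀ z : ZMod 2, z + z = 0 := CharTwo.add_self_eq_zero
  have eqo : ∀ z z' : ZMod 2, z + z' = 0 → z = z' := fun z z' h => by
    linear_combination h - c2 z'
  have gC : ∀ a b, J C a b → g a = g b := by
    intro a b h
    induction h with
    | refl _ => rfl
    | @step x y hx ad m ih =>
      rw [ih]
      apply eqo
      rw [hg _ _ ad]
      have n1 : y ∉ Γ := fun h => hΓC _ h m
      have n2 : x ∉ Γ := fun h => hΓC _ h hx.right_mem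
      simp [hcdef, n1, n2]
  have gCc : ∀ a b, J Cᶜ a b → g a = g b := by
    intro a b h
    induction h with
    | refl _ => rfl
    | @step x y hx ad m ih =>
      rw [ih]
      apply eqo
      rw [hg _ _ ad]
      have n1 : y ∉ C := m
      have n2 : x ∉ C := hx.right_mem
      simp [hcdef, n1, n2]
  obtain ⟨hu1, a, ha, hua⟩ := hu
  obtain ⟨hv1, b, hb, hvb⟩ := hv
  have e1 := hg u a hua
  have e2 := hg v b hvb
  have uΓ : u ∈ Γ := J.refl ⟨hu1, a, ha, hua⟩
  have vΓ : v ∉ Γ := hnot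
  have r1 : c u a = 1 := by simp [hcdef, ha, uΓ]
  have r2 : c v b = 0 := by simp [hcdef, hv1, vΓ]
  rw [r1] at e1
  rw [r2, ← gC a b (hC a ha b hb), ← gCc u v huv, e1] at e2
  exact one_ne_zero e2


/-! ### No crossing implies a dual crossing -/

def lin (α β : ℝ) (v : Site) : ℝ := α * v.1 + β * v.2

lemma lin_add (α β : ℝ) (u v : Site) : lin α β (u + v) = lin α β u + lin α β v := by
  simp [lin]; ring

lemma lin_nsmul (α β : ℝ) (k : ℕ) (v : Site) : lin α β (k • v) = k * lin α β v := by
  simp [lin]; ring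

lemma lin_neg (α β : ℝ) (v : Site) : lin α β (-v) = -lin α β v := by
  simp [lin]; ring

/-- unit lattice vectors. -/
def IsU (e : Site) : Prop := ∀ v : Site, Tri.Adj v (v + e)

lemma isU_of (e : Site) (h : e.1 ^ 2 + e.1 * e.2 + e.2 ^ 2 = 1) : IsU e := by
  intro v
  rw [adj_iff]
  simp only [Prod.fst_add, Prod.snd_add]
  linarith

lemma IsU.neg {e : Site} (h : IsU e) : IsU (-e) := by
  intro v
  have := h (v + -e)
  rw [neg_add_cancel_right] at this
  exact Tri.adj_symm this

lemma line {S : Set Site} {u e : Site} (he : IsU e) (k : ℕ) (h : ∀ i ≤ k, u + i • e ∈ S) :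
    J S u (u + k • e) := by
  induction k with
  | zero => simpa using J.refl (by simpa using h 0 le_rfl)
  | succ k ih =>
    refine J.step (ih fun i hi => h i (by omega)) ?_ (h (k + 1) le_rfl)
    have := he (u + k • e)
    rwa [add_assoc, ← succ_nsmul] at this

lemma half_conn {α β c : ℝ} {e1 e2 : Site} (h1 : IsU e1) (h2 : IsU e2) (hp : lin α β e1 < 0)
    (hspan : ∀ w : Site, ∃ i j : ℤ, w = i • e1 + j • e2) {u v : Site}
    (hu : lin α β u < c) (hv : lin α β v < c) : J {x | lin α β x < c} u v := by
  obtain ⟨i, j, hij⟩ := hspan (v - u)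
  -- reduce to `j ≥ 0` by allowing `e2` or its opposite
  obtain ⟨e, he, k, hk⟩ : ∃ e : Site, IsU e ∧ ∃ k : ℕ, j • e2 = k • e := by
    rcases Int.eq_nat_or_neg j with ⟨k, rfl | rfl⟩
    · exact ⟨e2, h2, k, by simp⟩
    · exact ⟨-e2, h2.neg, k, by simp⟩
  obtain ⟨N, hN⟩ := exists_nat_gt ((lin α β u - c + k * |lin α β e|) / (-lin α β e1))
  rw [div_lt_iff₀ (by linarith)] at hN
  set M : ℕ := N + i.natAbs with hM
  obtain ⟨M', hM'⟩ : ∃ M' : ℕ, (M' : ℤ) = M - i := ⟨(M - i).toNat, by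
    rw [Int.toNat_of_nonneg]; omega⟩
  have hNM : (N : ℝ) ≤ M := by exact_mod_cast (by omega : N ≤ M)
  have p1 : J {x | lin α β x < c} u (u + M • e1) := by
    refine line h1 M fun i _ => ?_
    change lin α β (u + i • e1) < c
    rw [lin_add, lin_nsmul]
    have : (i : ℝ) * lin α β e1 ≤ 0 := mul_nonpos_of_nonneg_of_nonpos (by positivity) hp.le
    linarith
  have p2 : J {x | lin α β x < c} (u + M • e1) (u + M • e1 + k • e) := by
    refine line he k fun i hi => ?_
    change lin α β (u + M • e1 + i • e) < c
    rw [lin_add, lin_add, lin_nsmul, lin_nsmul]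
    have a1 : (i : ℝ) * lin α β e ≤ k * |lin α β e| :=
      (mul_le_mul_of_nonneg_left (le_abs_self _) (by positivity)).trans
        (mul_le_mul_of_nonneg_right (by exact_mod_cast hi) (abs_nonneg _))
    have a2 : (M : ℝ) * lin α β e1 ≤ N * lin α β e1 := mul_le_mul_of_nonpos_right hNM hp.le
    linarith
  have p3 : J {x | lin α β x < c} v (v + M' • e1) := by
    refine line h1 M' fun i _ => ?_
    change lin α β (v + i • e1) < c
    rw [lin_add, lin_nsmul]
    have : (i : ℝ) * lin α β e1 ≤ 0 := mul_nonpos_of_nonneg_of_nonpos (by positivity) hp.le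
    linarith
  have e3 : v + M' • e1 = u + M • e1 + k • e := by
    have q1 : v = u + (i • e1 + j • e2) := by rw [← hij]; abel
    have q2 : (M' : ℕ) • e1 = (M : ℤ) • e1 - i • e1 := by
      rw [← sub_smul, ← hM', natCast_zsmul]
    rw [q2, q1, hk, natCast_zsmul]
    abel
  rw [e3] at p3
  exact (p1.trans p2).trans p3.symm

/-- The rectangle in local coordinates. -/
def RL (a : ℝ) (l t : Site → ℝ) : Set Site := {v | (-a ≤ l v ∧ l v ≤ 3 * a) ∧ -a ≤ t v ∧ t v ≤ a}

/-- a point just right of the left side, and joined to far away on the right, outside the strip -/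
lemma side_pt {α β γ α' β' γ' a : ℝ} {e w0 : Site} (he : IsU e) (hl : 0 < lin α β e)
    (ht : 0 ≤ lin α' β' e) (hw : lin α β w0 + γ < -a) (hw' : a < lin α' β' w0 + γ') :
    ∃ u r, J {x | -a ≤ lin α β x + γ ∧ a < lin α' β' x + γ'} u r ∧
      (∃ b, Tri.Adj u b ∧ lin α β b + γ < -a) ∧ 3 * a < lin α β r + γ := by
  obtain ⟨N, hN⟩ := exists_nat_gt ((-a - γ - lin α β w0) / lin α β e)
  obtain ⟨N', hN'⟩ := exists_nat_gt ((3 * a - γ - lin α β w0) / lin α β e)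
  rw [div_lt_iff₀ hl] at hN hN'
  have hex : ∃ n : ℕ, -a ≤ lin α β (w0 + n • e) + γ := ⟨N, by
    rw [lin_add, lin_nsmul]; linarith⟩
  classical
  set k := Nat.find hex with hk
  have k1 := Nat.find_spec hex
  rw [← hk] at k1
  have k0 : k ≠ 0 := by
    intro h
    rw [h] at k1
    simp at k1
    linarith
  have k2 := Nat.find_min hex (m := k - 1) (by omega)
  have kk : w0 + k • e = w0 + (k - 1) • e + e := by
    rw [add_assoc, ← succ_nsmul, Nat.sub_add_cancel (by omega)]
  have tpos : ∀ i : ℕ, 0 ≤ (i : ℝ) * lin α' β' e := fun i => mul_nonneg (by positivity) ht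
  have lpos : ∀ i : ℕ, 0 ≤ (i : ℝ) * lin α β e := fun i => mul_nonneg (by positivity) hl.le
  refine ⟨w0 + k • e, w0 + k • e + N' • e, line he N' ?_, ⟨w0 + (k - 1) • e, ?_, not_le.1 k2⟩, ?_⟩
  · intro i _
    refine ⟨?_, ?_⟩
    · rw [lin_add]; rw [lin_nsmul]; have := lpos i; linarith
    · rw [lin_add, lin_add, lin_nsmul, lin_nsmul]; have := tpos i; have := tpos k; linarith
  · rw [kk]; exact Tri.adj_symm (he _)
  · rw [lin_add, lin_add, lin_nsmul, lin_nsmul]; have := lpos k; linarith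

lemma dual {p a : ℝ} (ω : Site → ℝ) {α β γ α' β' γ' : ℝ} (ha : 1 ≤ a)
    (hL : ∀ u v, Tri.Adj u v → |lin α β u - lin α β v| ≤ 1)
    (hT : ∀ u v, Tri.Adj u v → |lin α' β' u - lin α' β' v| ≤ 1)
    {et eb e2 w1 w2 : Site} (h1 : IsU et) (h2 : IsU eb) (h3 : IsU e2)
    (hl1 : 0 < lin α β et) (ht1 : 0 ≤ lin α' β' et)
    (hl2 : 0 < lin α β eb) (ht2 : lin α' β' eb ≤ 0)
    (hspan : ∀ w : Site, ∃ i j : ℤ, w = i • et + j • e2)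
    (hw1 : lin α β w1 + γ < -a) (hw1' : a < lin α' β' w1 + γ')
    (hw2 : lin α β w2 + γ < -a) (hw2' : lin α' β' w2 + γ' < -a) :
    (∃ u v, J (RL a (fun x => lin α β x + γ) (fun x => lin α' β' x + γ') ∩ Bl p ω) u v ∧
      lin α β u + γ ≤ -a + 1 ∧ 3 * a - 1 ≤ lin α β v + γ) ∨
    (∃ u v, J (RL a (fun x => lin α β x + γ) (fun x => lin α' β' x + γ') ∩ {x | p < ω x}) u v ∧
      lin α' β' u + (2 * a - 2) ≤ lin α' β' v) := by
  rw [or_iff_not_imp_left]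
  intro hno
  set R := RL a (fun x => lin α β x + γ) (fun x => lin α' β' x + γ') with hR
  set Hl : Set Site := {x | lin α β x < -a - γ} with hHl
  set D : Set Site := Hl ∪ (R ∩ Bl p ω) with hD
  set C : Set Site := {x | J D w1 x} with hCdef
  have span' : ∀ w : Site, ∃ i j : ℤ, w = i • (-et) + j • e2 := by
    intro w
    obtain ⟨i, j, h⟩ := hspan w
    exact ⟨-i, j, by rw [h]; simp⟩
  have w1H : w1 ∈ Hl := by change lin α β w1 < -a - γ; linarith
  have HlC : ∀ x ∈ Hl, x ∈ C := fun x hx =>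
    (half_conn h1.neg h3 (by rw [lin_neg]; linarith) span' w1H hx).mono Set.subset_union_left
  have CD : ∀ x ∈ C, x ∈ D := fun x hx => J.right_mem hx
  have CC : ∀ x ∈ C, ∀ y ∈ C, J C x y := by
    have : ∀ x ∈ C, J C w1 x := fun x hx => (J.comp hx).mono Set.inter_subset_right
    exact fun x hx y hy => (this x hx).symm.trans (this y hy)
  have Clt : ∀ x ∈ C, lin α β x + γ < 3 * a - 1 := by
    intro x hx
    by_contra hcon
    push Not at hcon
    rcases CD x hx with h | h
    · have h : lin α β x < -a - γ := h
      linarith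
    · obtain ⟨w, w', g1, g2, g3, g4⟩ := (J.symm hx).first_exit (E := R ∩ Bl p ω) h (fun h' => by
        have h' : -a ≤ lin α β w1 + γ := h'.1.1.1
        linarith)
      have g5 : lin α β w' < -a - γ := by
        rcases g3 with h | h
        · exact h
        · exact absurd h g4
      have g6 := abs_le.1 (hL w w' g2)
      exact hno ⟨w, x, (g1.mono Set.inter_subset_right).symm, by linarith, hcon⟩
  have notC : ∀ x, -a ≤ lin α β x + γ → x ∉ R → x ∉ C := by
    intro x h h' hx
    rcases CD x hx with g | g
    · have g : lin α β x < -a - γ := g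
      linarith
    · exact h' g.1
  have bdry : ∀ x ∈ oB C, -a ≤ lin α' β' x + γ' → lin α' β' x + γ' ≤ a → x ∈ R ∩ {x | p < ω x} := by
    rintro x ⟨hx, y, hy, hxy⟩ q1 q2
    have b1 : -a ≤ lin α β x + γ := by
      by_contra h
      exact hx (HlC x (by change lin α β x < -a - γ; linarith))
    have b2 := Clt y hy
    have b3 := abs_le.1 (hL x y hxy)
    have xR : x ∈ R := ⟨⟨b1, by change lin α β x + γ ≤ 3 * a; linarith⟩, q1, q2⟩
    refine ⟨xR, ?_⟩
    change p < ω x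
    by_contra hb
    exact hx (J.step hy (Tri.adj_symm hxy) (Or.inr ⟨xR, not_lt.1 hb⟩))
  obtain ⟨u, r, u1, ⟨b, u2, u3⟩, u4⟩ := side_pt h1 hl1 ht1 hw1 hw1'
  have sb := side_pt (α' := -α') (β' := -β') (γ' := -γ') (γ := γ) (w0 := w2) (a := a) h2 hl2
    (by simp only [lin] at ht2 ⊢; linarith) hw2 (by simp only [lin] at hw2' ⊢; linarith)
  obtain ⟨v, s, v1, ⟨b', v2, v3⟩, v4⟩ := sb
  have lneg : ∀ x, lin (-α') (-β') x = - lin α' β' x := fun x => by simp only [lin]; ring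
  have uB : u ∈ oB C := ⟨notC u u1.left_mem.1 (fun h => by
      have g : lin α' β' u + γ' ≤ a := h.2.2
      have g' := u1.left_mem.2
      linarith), b, HlC b (by change lin α β b < -a - γ; linarith), u2⟩
  have vlt : lin α' β' v + γ' < -a := by
    have := v1.left_mem.2
    rw [lneg] at this
    linarith
  have vB : v ∈ oB C := ⟨notC v v1.left_mem.1 (fun h => by
      have g : -a ≤ lin α' β' v + γ' := h.2.1
      linarith), b', HlC b' (by change lin α β b' < -a - γ; linarith), v2⟩
  have j1 : J Cᶜ u r := u1.mono fun x hx => notC x hx.1 fun h => by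
    have g : lin α' β' x + γ' ≤ a := h.2.2
    have g' := hx.2
    linarith
  have j2 : J Cᶜ v s := v1.mono fun x hx => notC x hx.1 fun h => by
    have g : -a ≤ lin α' β' x + γ' := h.2.1
    have g' := hx.2
    rw [lneg] at g'
    linarith
  have lneg' : ∀ x, lin (-α) (-β) x = - lin α β x := fun x => by simp only [lin]; ring
  have j3 : J Cᶜ r s := by
    have := half_conn (α := -α) (β := -β) (c := γ - 3 * a) (u := r) (v := s) h1 h3
      (by rw [lneg']; linarith) hspan (by rw [lneg']; linarith) (by rw [lneg']; linarith)
    refine this.mono fun x hx => ?_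
    have hx : lin (-α) (-β) x < γ - 3 * a := hx
    rw [lneg'] at hx
    intro hxC
    have := Clt x hxC
    linarith
  have jB := boundary_conn CC uB vB ((j1.trans j3).trans j2.symm)
  have ugt : a < lin α' β' u + γ' := u1.left_mem.2
  obtain ⟨x, x', f1, f2, -, f4⟩ := jB.first_exit (E := {x | -a ≤ lin α' β' x + γ'})
    (show -a ≤ lin α' β' u + γ' by linarith) (show ¬ (-a ≤ lin α' β' v + γ') by linarith)
  have f4 : ¬ (-a ≤ lin α' β' x' + γ') := f4
  have f5 := abs_le.1 (hT x x' f2)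
  obtain ⟨y, y', g1, g2, -, g4⟩ := f1.symm.first_exit (E := {x | lin α' β' x + γ' ≤ a})
    (show lin α' β' x + γ' ≤ a by linarith) (show ¬ (lin α' β' u + γ' ≤ a) by linarith)
  have g4 : ¬ (lin α' β' y' + γ' ≤ a) := g4
  have g5 := abs_le.1 (hT y y' g2)
  refine ⟨x, y, g1.mono ?_, by linarith⟩
  rintro z ⟨⟨z1, z2⟩, z3⟩
  exact bdry z z1 z2 z3


/-! ### Application to the rectangles of the net event -/

/-- half the square root of three. -/
def hs : ℝ := Real.sqrt 3 / 2

lemma hs_le : hs ≤ 1 := by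
  unfold hs
  have : Real.sqrt 3 ≤ 2 := by rw [Real.sqrt_le_left (by norm_num)]; norm_num
  linarith

lemma hs_ge : 0.85 ≤ hs := by
  unfold hs
  have : (1.7 : ℝ) ≤ Real.sqrt 3 := Real.le_sqrt_of_sq_le (by norm_num)
  linarith

lemma lip_re (u v : Site) (h : Tri.Adj u v) : |lin 1 (1 / 2) u - lin 1 (1 / 2) v| ≤ 1 := by
  have : lin 1 (1 / 2) u - lin 1 (1 / 2) v = ((u.1 - v.1 : ℤ) : ℝ) + ((u.2 - v.2 : ℤ) : ℝ) / 2 := by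
    simp only [lin]; push_cast; ring
  rw [this, abs_le]
  rcases adj_cases h with ⟨h1, h2⟩ | ⟨h1, h2⟩ | ⟨h1, h2⟩ | ⟨h1, h2⟩ | ⟨h1, h2⟩ | ⟨h1, h2⟩ <;>
    rw [h1, h2] <;> norm_num

lemma lip_im (u v : Site) (h : Tri.Adj u v) : |lin 0 hs u - lin 0 hs v| ≤ 1 := by
  have : lin 0 hs u - lin 0 hs v = hs * ((u.2 - v.2 : ℤ) : ℝ) := by
    simp only [lin]; push_cast; ring
  have h0 := hs_le
  have h0' := hs_ge
  rw [this, abs_le]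
  rcases adj_cases h with ⟨h1, h2⟩ | ⟨h1, h2⟩ | ⟨h1, h2⟩ | ⟨h1, h2⟩ | ⟨h1, h2⟩ | ⟨h1, h2⟩ <;>
    rw [h2] <;> push_cast <;> constructor <;> linarith

lemma lip_neg {α β : ℝ} (h : ∀ u v, Tri.Adj u v → |lin α β u - lin α β v| ≤ 1) :
    ∀ u v, Tri.Adj u v → |lin (-α) (-β) u - lin (-α) (-β) v| ≤ 1 := by
  intro u v a
  have e : lin (-α) (-β) u - lin (-α) (-β) v = -(lin α β u - lin α β v) := by
    simp only [lin]; ring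
  rw [e, abs_neg]
  exact h u v a

lemma ex_int {α : ℝ} (h : α ≠ 0) (c : ℝ) : ∃ k : ℤ, c < α * k := by
  rcases lt_or_gt_of_ne h with h | h
  · obtain ⟨n, hn⟩ := exists_nat_gt (c / (-α))
    rw [div_lt_iff₀ (by linarith)] at hn
    exact ⟨-n, by push_cast; linarith⟩
  · obtain ⟨n, hn⟩ := exists_nat_gt (c / α)
    rw [div_lt_iff₀ h] at hn
    exact ⟨n, by push_cast; linarith⟩

lemma pt1 {α β α' β' : ℝ} (h0 : α' = 0) (h1 : α ≠ 0) (h2 : β' ≠ 0) (c c' : ℝ) :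
    ∃ w, lin α β w < c ∧ c' < lin α' β' w := by
  obtain ⟨y, hy⟩ := ex_int h2 c'
  obtain ⟨x, hx⟩ := ex_int (neg_ne_zero.2 h1) (β * y - c)
  refine ⟨(x, y), ?_, ?_⟩ <;> simp only [lin, h0] <;> linarith

lemma pt2 {α β α' β' : ℝ} (h0 : α = 0) (h1 : β ≠ 0) (h2 : α' ≠ 0) (c c' : ℝ) :
    ∃ w, lin α β w < c ∧ c' < lin α' β' w := by
  obtain ⟨y, hy⟩ := ex_int (neg_ne_zero.2 h1) (-c)
  obtain ⟨x, hx⟩ := ex_int h2 (c' - β' * y)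
  refine ⟨(x, y), ?_, ?_⟩ <;> simp only [lin, h0] <;> linarith

lemma ctr_re (a : ℝ) (x : ℤ × ℤ) : (ctr a x).re = 2 * a * x.1 := by
  simp [ctr]

lemma ctr_im (a : ℝ) (x : ℤ × ℤ) : (ctr a x).im = 2 * a * x.2 := by
  simp [ctr]

lemma dir_re (x x' : ℤ × ℤ) : (dirC x x').re = x'.1 - x.1 := by
  simp [dirC]

lemma dir_im (x x' : ℤ × ℤ) : (dirC x x').im = x'.2 - x.2 := by
  simp [dirC]

lemma long_re (a : ℝ) (x x' : ℤ × ℤ) (v : Site) :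
    ((embed v - ctr a x) * (starRingEnd ℂ) (dirC x x')).re =
      (lin 1 (1 / 2) v - 2 * a * x.1) * (x'.1 - x.1) + (lin 0 hs v - 2 * a * x.2) * (x'.2 - x.2) := by
  rw [Complex.mul_re, Complex.conj_re, Complex.conj_im, Complex.sub_re, Complex.sub_im, dir_re,
    dir_im, ctr_re, ctr_im, embed_re, embed_im]
  simp only [lin, hs]
  ring

lemma mem_boxAt (a : ℝ) (x : ℤ × ℤ) (v : Site) : v ∈ boxAt a (ctr a x) ↔
    |lin 1 (1 / 2) v - 2 * a * x.1| ≤ a ∧ |lin 0 hs v - 2 * a * x.2| ≤ a := by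
  change |(embed v - ctr a x).re| ≤ a ∧ |(embed v - ctr a x).im| ≤ a ↔ _
  rw [Complex.sub_re, Complex.sub_im, ctr_re, ctr_im, embed_re, embed_im]
  have e1 : (v.1 : ℝ) + v.2 / 2 = lin 1 (1 / 2) v := by simp only [lin]; ring
  have e2 : (v.2 : ℝ) * (Real.sqrt 3 / 2) = lin 0 hs v := by simp only [lin, hs]; ring
  rw [e1, e2]

/-- the region containing the rectangle. -/
def Dx (a : ℝ) (x : ℤ × ℤ) : Set Site :=
  {v | |lin 1 (1 / 2) v - 2 * a * x.1| ≤ 3 * a ∧ |lin 0 hs v - 2 * a * x.2| ≤ 3 * a}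

lemma gap_im {a : ℝ} {ν : ℤ} (hν : 1 ≤ ν) (ha : 32 * (ν : ℝ) ≤ a) {u v : Site}
    (h : lin 0 hs u + (2 * a - 2) ≤ lin 0 hs v) :
    ∃ f : Fin 3, gF f u + 24 * ν ≤ gF f v ∨ gF f v + 24 * ν ≤ gF f u := by
  have hν' : (1 : ℝ) ≤ ν := by exact_mod_cast hν
  have h1 : (64 * ν - 2 : ℝ) ≤ hs * ((v.2 - u.2 : ℤ) : ℝ) := by
    simp only [lin] at h; push_cast; linarith
  have h2 : 0 ≤ v.2 - u.2 := by
    by_contra hc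
    have : ((v.2 - u.2 : ℤ) : ℝ) ≤ 0 := by exact_mod_cast (by omega)
    have := mul_nonpos_of_nonneg_of_nonpos (by linarith [hs_ge] : (0 : ℝ) ≤ hs) this
    linarith
  have h3 : (64 * ν - 2 : ℝ) ≤ ((v.2 - u.2 : ℤ) : ℝ) := by
    refine h1.trans ?_
    have : (0 : ℝ) ≤ ((v.2 - u.2 : ℤ) : ℝ) := by exact_mod_cast h2
    nlinarith [hs_le]
  have h4 : 64 * ν - 2 ≤ v.2 - u.2 := by exact_mod_cast h3
  by_cases hc : gF 1 u + 24 * ν ≤ gF 1 v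
  · exact ⟨1, Or.inl hc⟩
  · refine ⟨2, Or.inr ?_⟩
    rw [gF1, gF1] at hc
    rw [gF2, gF2]
    simp only [fB, fC] at *
    omega

lemma gap_re {a : ℝ} {ν : ℤ} (hν : 1 ≤ ν) (ha : 32 * (ν : ℝ) ≤ a) {u v : Site}
    (h : lin 1 (1 / 2) u + (2 * a - 2) ≤ lin 1 (1 / 2) v) :
    ∃ f : Fin 3, gF f u + 24 * ν ≤ gF f v ∨ gF f v + 24 * ν ≤ gF f u := by
  refine ⟨0, Or.inl ?_⟩
  rw [gF0, gF0]
  have hν' : (1 : ℝ) ≤ ν := by exact_mod_cast hν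
  have : ((fA u + 24 * ν : ℤ) : ℝ) ≤ (fA v : ℤ) := by
    simp only [fA, lin] at *
    push_cast
    linarith
  exact_mod_cast this

lemma gap_order {D : Set Site} {ν : ℤ} {u v : Site} (h : J D u v)
    (hf : ∃ f : Fin 3, gF f u + 24 * ν ≤ gF f v ∨ gF f v + 24 * ν ≤ gF f u) :
    ∃ u v, J D u v ∧ ∃ f : Fin 3, gF f u + 24 * ν ≤ gF f v := by
  obtain ⟨f, hf | hf⟩ := hf
  · exact ⟨u, v, h, f, hf⟩
  · exact ⟨v, u, h.symm, f, hf⟩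

lemma no_long {p a : ℝ} (ω : Site → ℝ) {ν : ℤ} (hν : 1 ≤ ν) (ha : 32 * (ν : ℝ) ≤ a)
    {x x' : ℤ × ℤ} (hx : IntAdj x x') (hno : ¬ LongCross p a ω x x') :
    ∃ u v, J (Dx a x ∩ {y | p < ω y}) u v ∧ ∃ f : Fin 3, gF f u + 24 * ν ≤ gF f v := by
  have hν' : (1 : ℝ) ≤ ν := by exact_mod_cast hν
  have ha1 : 1 ≤ a := by linarith
  have s1 := hs_ge
  have hs0 : hs ≠ 0 := by linarith
  have hs0' : -hs ≠ 0 := neg_ne_zero.2 hs0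
  have hc : (x'.1 = x.1 + 1 ∧ x'.2 = x.2) ∨ (x'.1 = x.1 - 1 ∧ x'.2 = x.2) ∨
      (x'.1 = x.1 ∧ x'.2 = x.2 + 1) ∨ (x'.1 = x.1 ∧ x'.2 = x.2 - 1) := by
    unfold IntAdj at hx
    omega
  have fin : ∀ (α β γ α' β' γ' : ℝ), (∀ v : Site, (lin 1 (1 / 2) v - 2 * a * x.1) * (x'.1 - x.1) +
        (lin 0 hs v - 2 * a * x.2) * (x'.2 - x.2) = lin α β v + γ) →
      (∀ v ∈ RL a (fun x => lin α β x + γ) (fun x => lin α' β' x + γ'),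
        (v ∈ boxAt a (ctr a x) ∪ boxAt a (ctr a x')) ∧ v ∈ Dx a x) →
      (∀ u v, lin α' β' u + (2 * a - 2) ≤ lin α' β' v →
        ∃ f : Fin 3, gF f u + 24 * ν ≤ gF f v ∨ gF f v + 24 * ν ≤ gF f u) →
      ((∃ u v, J (RL a (fun x => lin α β x + γ) (fun x => lin α' β' x + γ') ∩ Bl p ω) u v ∧
      lin α β u + γ ≤ -a + 1 ∧ 3 * a - 1 ≤ lin α β v + γ) ∨
    (∃ u v, J (RL a (fun x => lin α β x + γ) (fun x => lin α' β' x + γ') ∩ {x | p < ω x}) u v ∧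
      lin α' β' u + (2 * a - 2) ≤ lin α' β' v)) →
      ∃ u v, J (Dx a x ∩ {y | p < ω y}) u v ∧ ∃ f : Fin 3, gF f u + 24 * ν ≤ gF f v := by
    intro α β γ α' β' γ' k1 k2 k3 k4
    rcases k4 with ⟨u, v, h1, h2, h3⟩ | ⟨u, v, h1, h2⟩
    · refine absurd ⟨u, v, connIn_of_J (h1.mono ?_), ?_, ?_⟩ hno
      · rintro y ⟨y1, y2⟩
        exact ⟨(k2 y y1).1, y2⟩
      · rw [long_re, k1]; exact h2
      · rw [long_re, k1]; exact h3
    · refine gap_order (h1.mono ?_) (k3 u v h2)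
      rintro y ⟨y1, y2⟩
      exact ⟨(k2 y y1).2, y2⟩
  have nlin : ∀ α β (v : Site), lin (-α) (-β) v = -lin α β v := fun α β v => by
    simp only [lin]; ring
  rcases hc with ⟨e1, e2⟩ | ⟨e1, e2⟩ | ⟨e1, e2⟩ | ⟨e1, e2⟩
  · obtain ⟨w1, p1, p1'⟩ := pt1 (α := 1) (β := 1 / 2) (α' := 0) (β' := hs) rfl one_ne_zero hs0
      (-a + 2 * a * x.1) (a + 2 * a * x.2)
    obtain ⟨w2, p2, p2'⟩ := pt1 (α := 1) (β := 1 / 2) (α' := -0) (β' := -hs) neg_zero one_ne_zero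
      hs0' (-a + 2 * a * x.1) (a - 2 * a * x.2)
    rw [nlin] at p2'
    refine fin 1 (1 / 2) (-(2 * a * x.1)) 0 hs (-(2 * a * x.2)) ?_ ?_ ?_
      (dual ω ha1 lip_re lip_im (isU_of (1, 0) (by norm_num)) (isU_of (1, 0) (by norm_num))
        (isU_of (0, 1) (by norm_num)) (by norm_num [lin]) (by norm_num [lin]) (by norm_num [lin])
        (by norm_num [lin]) (fun w => ⟨w.1, w.2, by ext <;> simp⟩) (w1 := w1) (w2 := w2)
        (by linarith) (by linarith) (by linarith) (by linarith))
    · intro v; rw [e1, e2]; push_cast; ring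
    · rintro v ⟨⟨v1, v2⟩, v3, v4⟩
      simp only [] at v1 v2 v3 v4
      rw [Set.mem_union, mem_boxAt, mem_boxAt, e1, e2]
      push_cast
      refine ⟨?_, abs_le.2 ⟨?_, ?_⟩, abs_le.2 ⟨?_, ?_⟩⟩ <;> try linarith
      by_cases hh : lin 1 (1 / 2) v - 2 * a * x.1 ≤ a
      · left; refine ⟨abs_le.2 ⟨?_, ?_⟩, abs_le.2 ⟨?_, ?_⟩⟩ <;> linarith
      · right; refine ⟨abs_le.2 ⟨?_, ?_⟩, abs_le.2 ⟨?_, ?_⟩⟩ <;> linarith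
    · intro u v h
      exact gap_im hν ha h
  · obtain ⟨w1, p1, p1'⟩ := pt1 (α := -1) (β := -(1 / 2)) (α' := -0) (β' := -hs) neg_zero
      (by norm_num) hs0' (-a - 2 * a * x.1) (a - 2 * a * x.2)
    obtain ⟨w2, p2, p2'⟩ := pt1 (α := -1) (β := -(1 / 2)) (α' := 0) (β' := hs) rfl (by norm_num)
      hs0 (-a - 2 * a * x.1) (a + 2 * a * x.2)
    refine fin (-1) (-(1 / 2)) (2 * a * x.1) (-0) (-hs) (2 * a * x.2) ?_ ?_ ?_
      (dual ω ha1 (lip_neg lip_re) (lip_neg lip_im) (isU_of (-1, 0) (by norm_num))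
        (isU_of (-1, 0) (by norm_num))
        (isU_of (0, 1) (by norm_num)) (by norm_num [lin]) (by norm_num [lin]) (by norm_num [lin])
        (by norm_num [lin]) (fun w => ⟨-w.1, w.2, by ext <;> simp⟩) (w1 := w1) (w2 := w2)
        (by linarith) (by linarith) (by linarith) (by rw [nlin]; linarith))
    · intro v; rw [e1, e2, nlin]; push_cast; ring
    · rintro v ⟨⟨v1, v2⟩, v3, v4⟩
      simp only [nlin] at v1 v2 v3 v4
      rw [Set.mem_union, mem_boxAt, mem_boxAt, e1, e2]
      push_cast
      refine ⟨?_, abs_le.2 ⟨?_, ?_⟩, abs_le.2 ⟨?_, ?_⟩⟩ <;> try linarith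
      by_cases hh : -lin 1 (1 / 2) v + 2 * a * x.1 ≤ a
      · left; refine ⟨abs_le.2 ⟨?_, ?_⟩, abs_le.2 ⟨?_, ?_⟩⟩ <;> linarith
      · right; refine ⟨abs_le.2 ⟨?_, ?_⟩, abs_le.2 ⟨?_, ?_⟩⟩ <;> linarith
    · intro u v h
      rw [nlin, nlin] at h
      obtain ⟨f, hf⟩ := gap_im hν ha (u := v) (v := u) (by linarith)
      exact ⟨f, hf.symm⟩
  · obtain ⟨w1, p1, p1'⟩ := pt2 (α := 0) (β := hs) (α' := -1) (β' := -(1 / 2)) rfl hs0 (by norm_num)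
      (-a + 2 * a * x.2) (a - 2 * a * x.1)
    obtain ⟨w2, p2, p2'⟩ := pt2 (α := 0) (β := hs) (α' := 1) (β' := 1 / 2) rfl hs0 (by norm_num)
      (-a + 2 * a * x.2) (a + 2 * a * x.1)
    refine fin 0 hs (-(2 * a * x.2)) (-1) (-(1 / 2)) (2 * a * x.1) ?_ ?_ ?_
      (dual ω ha1 lip_im (lip_neg lip_re) (isU_of (-1, 1) (by norm_num))
        (isU_of (0, 1) (by norm_num))
        (isU_of (0, 1) (by norm_num)) (by norm_num [lin]; linarith) (by norm_num [lin])
        (by norm_num [lin]; linarith)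
        (by norm_num [lin]) (fun w => ⟨-w.1, w.1 + w.2, by ext <;> simp⟩) (w1 := w1) (w2 := w2)
        (by linarith) (by linarith) (by linarith) (by rw [nlin]; linarith))
    · intro v; rw [e1, e2]; push_cast; ring
    · rintro v ⟨⟨v1, v2⟩, v3, v4⟩
      simp only [nlin] at v1 v2 v3 v4
      rw [Set.mem_union, mem_boxAt, mem_boxAt, e1, e2]
      push_cast
      refine ⟨?_, abs_le.2 ⟨?_, ?_⟩, abs_le.2 ⟨?_, ?_⟩⟩ <;> try linarith
      by_cases hh : lin 0 hs v - 2 * a * x.2 ≤ a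
      · left; refine ⟨abs_le.2 ⟨?_, ?_⟩, abs_le.2 ⟨?_, ?_⟩⟩ <;> linarith
      · right; refine ⟨abs_le.2 ⟨?_, ?_⟩, abs_le.2 ⟨?_, ?_⟩⟩ <;> linarith
    · intro u v h
      rw [nlin, nlin] at h
      obtain ⟨f, hf⟩ := gap_re hν ha (u := v) (v := u) (by linarith)
      exact ⟨f, hf.symm⟩
  · obtain ⟨w1, p1, p1'⟩ := pt2 (α := -0) (β := -hs) (α' := 1) (β' := 1 / 2) neg_zero hs0'
      (by norm_num) (-a - 2 * a * x.2) (a + 2 * a * x.1)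
    obtain ⟨w2, p2, p2'⟩ := pt2 (α := -0) (β := -hs) (α' := -1) (β' := -(1 / 2)) neg_zero hs0'
      (by norm_num) (-a - 2 * a * x.2) (a - 2 * a * x.1)
    rw [nlin 1 (1 / 2)] at p2'
    refine fin (-0) (-hs) (2 * a * x.2) 1 (1 / 2) (-(2 * a * x.1)) ?_ ?_ ?_
      (dual ω ha1 (lip_neg lip_im) lip_re (isU_of (1, -1) (by norm_num))
        (isU_of (0, -1) (by norm_num))
        (isU_of (0, 1) (by norm_num)) (by norm_num [lin]; linarith) (by norm_num [lin])
        (by norm_num [lin]; linarith)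
        (by norm_num [lin]) (fun w => ⟨w.1, w.1 + w.2, by ext <;> simp⟩) (w1 := w1) (w2 := w2)
        (by linarith) (by linarith) (by linarith) (by linarith))
    · intro v; rw [e1, e2, nlin]; push_cast; ring
    · rintro v ⟨⟨v1, v2⟩, v3, v4⟩
      simp only [nlin] at v1 v2 v3 v4
      rw [Set.mem_union, mem_boxAt, mem_boxAt, e1, e2]
      push_cast
      refine ⟨?_, abs_le.2 ⟨?_, ?_⟩, abs_le.2 ⟨?_, ?_⟩⟩ <;> try linarith
      by_cases hh : -lin 0 hs v + 2 * a * x.2 ≤ a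
      · left; refine ⟨abs_le.2 ⟨?_, ?_⟩, abs_le.2 ⟨?_, ?_⟩⟩ <;> linarith
      · right; refine ⟨abs_le.2 ⟨?_, ?_⟩, abs_le.2 ⟨?_, ?_⟩⟩ <;> linarith
    · intro u v h
      exact gap_re hν ha h


/-! ### Final estimates -/

lemma near_pt (c1 c2 : ℝ) : ∃ z : Site, |lin 1 (1 / 2) z - c1| ≤ 1 ∧ |lin 0 hs z - c2| ≤ 1 := by
  have h1 := hs_le
  have h2 := hs_ge
  have hp : 0 < hs := by linarith
  set y : ℤ := ⌊c2 / hs⌋ with hy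
  set x : ℤ := ⌊c1 - y / 2⌋ with hx
  have a1 := Int.floor_le (c2 / hs)
  have a2 := Int.lt_floor_add_one (c2 / hs)
  have a3 := Int.floor_le (c1 - y / 2)
  have a4 := Int.lt_floor_add_one (c1 - y / 2)
  rw [← hy] at a1 a2
  rw [← hx] at a3 a4
  rw [le_div_iff₀ hp] at a1
  rw [div_lt_iff₀ hp] at a2
  refine ⟨(x, y), abs_le.2 ⟨?_, ?_⟩, abs_le.2 ⟨?_, ?_⟩⟩ <;> simp only [lin] <;> nlinarith

lemma Dx_bound {a : ℝ} {ν : ℤ} (hν : 1 ≤ ν) (ha : 32 * (ν : ℝ) ≤ a) (ha' : a ≤ 64 * ν) (x : ℤ × ℤ) :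
    ∃ z : Site, ∀ v ∈ Dx a x, |fA v - fA z| ≤ 8 * ν * 96 ∧ |fB v - fB z| ≤ 8 * ν * 96 ∧
      |fC v - fC z| ≤ 8 * ν * 96 := by
  obtain ⟨z, hz1, hz2⟩ := near_pt (2 * a * x.1) (2 * a * x.2)
  refine ⟨z, ?_⟩
  rintro v ⟨hv1, hv2⟩
  have hν' : (1 : ℝ) ≤ ν := by exact_mod_cast hν
  have h1 := hs_le
  have h2 := hs_ge
  rw [abs_le] at hz1 hz2 hv1 hv2
  simp only [lin] at hz1 hz2 hv1 hv2
  set dx : ℝ := (v.1 : ℝ) - z.1 with hdx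
  set dy : ℝ := (v.2 : ℝ) - z.2 with hdy
  have r1 : dx + dy / 2 ≤ 3 * a + 1 := by rw [hdx, hdy]; linarith
  have r2 : -(3 * a + 1) ≤ dx + dy / 2 := by rw [hdx, hdy]; linarith
  have r3 : hs * dy ≤ 3 * a + 1 := by rw [hdy]; linarith
  have r4 : -(3 * a + 1) ≤ hs * dy := by rw [hdy]; linarith
  have r5 : dy ≤ 1.2 * (3 * a + 1) := by
    by_contra hc
    push Not at hc
    nlinarith
  have r6 : -(1.2 * (3 * a + 1)) ≤ dy := by
    by_contra hc
    push Not at hc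
    nlinarith
  have c1 : ((fA v - fA z : ℤ) : ℝ) = 2 * (dx + dy / 2) := by
    simp only [fA, hdx, hdy]; push_cast; ring
  have c2 : ((fB v - fB z : ℤ) : ℝ) = (dx + dy / 2) - 3 / 2 * dy := by
    simp only [fB, hdx, hdy]; push_cast; ring
  have c3 : ((fC v - fC z : ℤ) : ℝ) = (dx + dy / 2) + 3 / 2 * dy := by
    simp only [fC, hdx, hdy]; push_cast; ring
  have conv : ∀ t : ℤ, -(8 * ν * 96 : ℝ) ≤ t → (t : ℝ) ≤ 8 * ν * 96 → |t| ≤ 8 * ν * 96 := by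
    intro t t1 t2
    rw [abs_le]
    exact ⟨by exact_mod_cast t1, by exact_mod_cast t2⟩
  refine ⟨conv _ ?_ ?_, conv _ ?_ ?_, conv _ ?_ ?_⟩ <;> first | rw [c1] | rw [c2] | rw [c3]
  all_goals linarith

/-- constant of the comparison. -/
def Cb : ℝ := 3 * ((2 * 96 + 1) * Mc 96)

lemma no_long_prob {μ : Measure (Site → ℝ)} (hμ : IsUniformCoupling μ) (p : ℝ) {a : ℝ} {ν : ℤ}
    (hν : 1 ≤ ν) (ha : 32 * (ν : ℝ) ≤ a) (ha' : a ≤ 64 * ν) (x x' : ℤ × ℤ) :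
    μ.real {ω | IntAdj x x' ∧ ¬ LongCross p a ω x x'} ≤ Cb * fR μ (1 - p) (8 * ν) := by
  have := hμ.1
  obtain ⟨z, hz⟩ := Dx_bound hν ha ha' x
  have h1 := big_ev hμ (1 - p) hν (H := 96) (by norm_num) z (Dx a x) hz
  set E := EvJ (1 - p) (Dx a x) (fun u v => ∃ f : Fin 3, gF f u + 24 * ν ≤ gF f v) with hE
  have hm : Measurable (fun (ω : Site → ℝ) v => 1 - ω v) := by fun_prop
  have e : μ.real E = μ.real ((fun (ω : Site → ℝ) v => 1 - ω v) ⁻¹' E) := by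
    simp only [Measure.real]
    conv_lhs => rw [← map_flip hμ]
    rw [Measure.map_apply hm (meas_EvJ' _ _ _)]
  have h2 : μ.real {ω | IntAdj x x' ∧ ¬ LongCross p a ω x x'} ≤ μ.real E := by
    rw [e]
    apply measureReal_mono _ (measure_ne_top _ _)
    rintro ω ⟨hω1, hω2⟩
    obtain ⟨u, v, hj, hf⟩ := no_long ω hν ha hω1 hω2
    refine ⟨u, v, hj.mono ?_, hf⟩
    rintro y ⟨y1, y2⟩
    have y2 : p < ω y := y2
    refine ⟨y1, ?_⟩
    change 1 - ω y ≤ 1 - p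
    linarith
  refine h2.trans (h1.trans (le_of_eq ?_))
  unfold Cb
  push_cast
  ring

lemma fR_le_cross {μ : Measure (Site → ℝ)} (hμ : IsUniformCoupling μ) (q : ℝ) (n : ℕ) :
    fR μ q n ≤ prob μ {ω | HCross q ω 0 n 0 (2 * n)} := by
  have := hμ.1
  change fR μ q n ≤ μ.real _
  apply measureReal_mono _ (measure_ne_top _ _)
  rintro ω ⟨u, v, hj, h1, h2⟩
  have hre : ∀ v, (embed v).re = (fA v : ℝ) / 2 := by
    intro v; rw [embed_re]; simp only [fA]; push_cast; ring
  refine ⟨u, v, connIn_of_J (hj.mono ?_), ?_, ?_⟩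
  · rintro x ⟨⟨x1, x2, x3, x4⟩, x5⟩
    have x1 : (0 : ℝ) ≤ fA x := by exact_mod_cast x1
    have x2 : (fA x : ℝ) ≤ 2 * n := by exact_mod_cast x2
    have x3 : (0 : ℝ) ≤ 10 * x.2 := by exact_mod_cast x3
    have x4 : (10 * x.2 : ℝ) ≤ 23 * n := by exact_mod_cast x4
    have s1 : Real.sqrt 3 ≤ 1.735 := by rw [Real.sqrt_le_left (by norm_num)]; norm_num
    have s0 : 0 ≤ Real.sqrt 3 := Real.sqrt_nonneg _
    refine ⟨⟨⟨?_, ?_⟩, ?_, ?_⟩, x5⟩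
    · rw [hre]; linarith
    · rw [hre]; linarith
    · rw [embed_im]; exact mul_nonneg (by linarith) (by linarith)
    · rw [embed_im]; nlinarith
  · have h1 : (fA u : ℝ) ≤ 2 := by exact_mod_cast h1
    rw [hre]; linarith
  · have h2 : (2 * n - 2 : ℝ) ≤ fA v := by exact_mod_cast h2
    rw [hre]; linarith

lemma above_L {μ : Measure (Site → ℝ)} (hμ : IsUniformCoupling μ) {p : ℝ} (hp : pc < p)
    (hL : Lnat μ p ≠ 0) (n : ℤ) (hn : (Lnat μ p : ℤ) + 1 ≤ n) : fR μ (1 - p) n ≤ 1 / 100 := by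
  obtain ⟨m, rfl⟩ := Int.eq_ofNat_of_zero_le (by omega : 0 ≤ n)
  have hp' : ¬ p < pc := not_lt.2 hp.le
  refine (fR_le_cross hμ (1 - p) m).trans ?_
  by_contra hc
  push Not at hc
  unfold Lnat at hL hn
  rw [if_neg hp'] at hL hn
  have hb : BddAbove {n : ℕ | (1 : ℝ) / 100 ≤ prob μ {ω | HCross (1 - p) ω 0 n 0 (2 * n)}} := by
    by_contra hnb
    exact hL (Nat.sSup_of_not_bddAbove hnb)
  have := le_csSup hb (show m ∈ {n : ℕ | (1 : ℝ) / 100 ≤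
    prob μ {ω | HCross (1 - p) ω 0 n 0 (2 * n)}} from hc.le)
  omega

lemma ex_dyadic {a w : ℝ} (hw : 0 < w) (h : w ≤ a) : ∃ k : ℕ, 2 ^ k * w ≤ a ∧ a < 2 ^ (k + 1) * w := by
  obtain ⟨k, h1, h2⟩ := exists_nat_pow_near (x := a / w) (y := 2) (by rw [le_div_iff₀ hw]; linarith)
    (by norm_num)
  rw [le_div_iff₀ hw] at h1
  rw [div_lt_iff₀ hw] at h2
  exact ⟨k, h1, h2⟩

lemma Mc_pos (H : ℤ) (h : 0 ≤ H) : 1 ≤ Mc H := by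
  have : (0 : ℝ) ≤ H := by exact_mod_cast h
  unfold Mc
  nlinarith

lemma net_union {μ : Measure (Site → ℝ)} (hμ : IsUniformCoupling μ) {p a b c : ℝ} (ha : 0 < a)
    (hab : a < b) (hc0 : 0 ≤ c)
    (hc : ∀ x x', μ.real {ω | IntAdj x x' ∧ ¬ LongCross p a ω x x'} ≤ c) :
    1 - 324 * (b / a) ^ 2 * c ≤ prob μ (NetEvent p a b) := by
  have := hμ.1
  set r : ℤ := ⌈b / (2 * a)⌉ + 1 with hr
  have hba : 1 < b / a := by rw [lt_div_iff₀ ha]; linarith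
  have e1 : b / (2 * a) = (b / a) / 2 := by field_simp
  have r1 : (r : ℝ) < (b / a) / 2 + 2 := by
    rw [hr, ← e1]; push_cast
    have := Int.ceil_lt_add_one (b / (2 * a))
    linarith
  have r0 : 0 < r := by
    have : 0 ≤ ⌈b / (2 * a)⌉ := Int.ceil_nonneg (by rw [e1]; linarith)
    omega
  have h1 := union_le hμ ((Finset.Icc (-r) r ×ˢ Finset.Icc (-r) r) ×ˢ
    (Finset.Icc (-1 : ℤ) 1 ×ˢ Finset.Icc (-1 : ℤ) 1))
    (fun t => {ω | IntAdj t.1 (t.1 + t.2) ∧ ¬ LongCross p a ω t.1 (t.1 + t.2)})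
    ((NetEvent p a b)ᶜ) ?_ c (fun t _ => hc _ _)
  · rw [Finset.card_product, Finset.card_product, Finset.card_product, Int.card_Icc, Int.card_Icc] at h1
    have c1 : ((r + 1 - -r).toNat : ℝ) = 2 * r + 1 := by
      have : ((r + 1 - -r).toNat : ℤ) = 2 * r + 1 := by
        rw [Int.toNat_of_nonneg (by omega)]; ring
      exact_mod_cast this
    push_cast at h1
    rw [c1] at h1
    have r0' : (0 : ℝ) < r := by exact_mod_cast r0
    have h2 : (2 * (r : ℝ) + 1) * (2 * r + 1) ≤ 36 * (b / a) ^ 2 := by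
      have : 2 * (r : ℝ) + 1 ≤ 6 * (b / a) := by linarith
      nlinarith
    have h3 : (2 * (r : ℝ) + 1) * (2 * r + 1) * 9 * c ≤ 36 * (b / a) ^ 2 * 9 * c := by
      gcongr
    have h4 : μ.real (NetEvent p a b ∪ (NetEvent p a b)ᶜ) ≤ μ.real (NetEvent p a b) +
        μ.real (NetEvent p a b)ᶜ := measureReal_union_le _ _
    rw [Set.union_compl_self, probReal_univ] at h4
    change _ ≤ μ.real (NetEvent p a b)
    linarith
  · intro ω hω
    have hω : ¬ (∀ x x' : ℤ × ℤ, x ∈ intBox (⌈b / (2 * a)⌉ + 1) →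
        x' ∈ intBox (⌈b / (2 * a)⌉ + 1) → IntAdj x x' → LongCross p a ω x x') := hω
    push Not at hω
    obtain ⟨x, x', h1, h2, h3, h4⟩ := hω
    refine ⟨(x, x' - x), ?_, ?_⟩
    · have a1 := abs_le.1 h1.1
      have a2 := abs_le.1 h1.2
      unfold IntAdj at h3
      simp only [Finset.mem_product, Finset.mem_Icc, Prod.fst_sub, Prod.snd_sub]
      omega
    · change IntAdj x (x + (x' - x)) ∧ ¬ LongCross p a ω x (x + (x' - x))
      rw [add_sub_cancel]
      exact ⟨h3, h4⟩

/-- Lemma 2.2 (nets). -/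
theorem net_event_probability
    (μ : Measure (Site → ℝ)) (hμ : IsUniformCoupling μ) :
    ∃ c₁ c₂ : ℝ, 0 < c₁ ∧ 0 < c₂ ∧
      ∀ a b p : ℝ, 0 < a → a < b → pc < p → p ≤ 1 →
        1 - c₁ * (b / a) ^ 2 * Real.exp (-c₂ * a / charL μ p) ≤
          prob μ (NetEvent p a b) := by
  have hM5 : 1 ≤ Mc 5 := Mc_pos 5 (by norm_num)
  have hM96 : 1 ≤ Mc 96 := Mc_pos 96 (by norm_num)
  have hCb : 0 ≤ Cb := by unfold Cb; positivity
  obtain ⟨n, hn⟩ := exists_pow_lt_of_lt_one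
    (show (0 : ℝ) < Real.exp (-1) / (3 * Mc 5 ^ 2) by positivity) (show (9 / 10 : ℝ) < 1 by norm_num)
  have hn2 : Mc 5 ^ 2 * (3 * (9 / 10) ^ (n + 2)) ≤ Real.exp (-1) := by
    rw [lt_div_iff₀ (by positivity)] at hn
    have : (9 / 10 : ℝ) ^ (n + 2) ≤ (9 / 10) ^ n :=
      pow_le_pow_of_le_one (by norm_num) (by norm_num) (by omega)
    calc Mc 5 ^ 2 * (3 * (9 / 10 : ℝ) ^ (n + 2)) ≤ Mc 5 ^ 2 * (3 * (9 / 10 : ℝ) ^ n) := by gcongr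
      _ = (9 / 10 : ℝ) ^ n * (3 * Mc 5 ^ 2) := by ring
      _ ≤ _ := hn.le
  set K : ℤ := 5625 * 30 ^ n with hK
  have hK1 : 1 ≤ K := by
    have : (0 : ℤ) < 30 ^ n := by positivity
    omega
  have hK1' : (1 : ℝ) ≤ K := by exact_mod_cast hK1
  have hc1 : (0 : ℝ) < 324 * Cb + 3 := by positivity
  refine ⟨324 * Cb + 3, 1 / (128 * K), hc1, by positivity, ?_⟩
  intro a b p ha hab hp _
  have hba : 1 ≤ (b / a) ^ 2 := by
    have : 1 < b / a := by rw [lt_div_iff₀ ha]; linarith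
    nlinarith
  have hprob : 0 ≤ prob μ (NetEvent p a b) := measureReal_nonneg
  -- the bound is trivial as soon as the exponential is at least `exp (-1)`
  have htriv : ∀ E : ℝ, Real.exp (-1) ≤ E →
      1 - (324 * Cb + 3) * (b / a) ^ 2 * E ≤ prob μ (NetEvent p a b) := by
    intro E hE
    have h3 : 1 ≤ 3 * Real.exp (-1) := by
      rw [Real.exp_neg, ← div_eq_mul_inv, le_div_iff₀ (Real.exp_pos _)]
      have := Real.exp_one_lt_d9
      linarith
    have hE0 : 0 ≤ E := (Real.exp_pos _).le.trans hE
    have h4 : 3 * 1 * Real.exp (-1) ≤ (324 * Cb + 3) * (b / a) ^ 2 * E := by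
      gcongr
      linarith
    linarith
  have hch : charL μ p = (Lnat μ p : ℝ) := rfl
  rw [hch]
  by_cases hL : Lnat μ p = 0
  · apply htriv
    rw [hL]
    apply Real.exp_le_exp.2
    simp
  have hL1 : (1 : ℝ) ≤ (Lnat μ p : ℝ) := by exact_mod_cast Nat.one_le_iff_ne_zero.2 hL
  set L : ℝ := (Lnat μ p : ℝ) with hLdef
  set e : ℤ := (Lnat μ p : ℤ) + 1 with he
  have he1 : 1 ≤ e := by omega
  have heL : (e : ℝ) = L + 1 := by rw [he, hLdef]; push_cast; ring
  have hm := multi hμ he1 (fun m hm => above_L hμ hp hL m hm) (n + 2)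
  have hν0 : 1 ≤ K * e := by nlinarith
  have heq : (50 * (30 ^ (n + 2) * e) : ℤ) = 8 * (K * e) := by rw [hK]; ring
  rw [heq] at hm
  have h0 : Mc 5 ^ 2 * fR μ (1 - p) (8 * (K * e)) ≤ Real.exp (-1) :=
    (mul_le_mul_of_nonneg_left hm (by positivity)).trans hn2
  have hexp : -(1 / (128 * (K : ℝ))) * a / L = -(a / (128 * K * L)) := by field_simp
  rw [hexp]
  have hKe : (K : ℝ) * e ≤ 2 * K * L := by rw [heL]; nlinarith
  have hν0' : (1 : ℝ) ≤ (K : ℝ) * e := by exact_mod_cast hν0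
  have hKL : 0 < 128 * (K : ℝ) * L := by positivity
  by_cases hsmall : a < 32 * ((K : ℝ) * e)
  · apply htriv
    apply Real.exp_le_exp.2
    apply neg_le_neg
    rw [div_le_iff₀ hKL]
    linarith
  push Not at hsmall
  obtain ⟨k, hk1, hk2⟩ := ex_dyadic (show 0 < 32 * ((K : ℝ) * e) by linarith) hsmall
  have hit := dyadic_iter hμ (1 - p) hν0 h0 k
  have hν : 1 ≤ 2 ^ k * (K * e) := by
    have : (0 : ℤ) < 2 ^ k := by positivity
    nlinarith
  have hf : fR μ (1 - p) (8 * (2 ^ k * (K * e))) ≤ Real.exp (-2 ^ k) := by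
    refine le_trans ?_ hit
    have := fR_nonneg μ (1 - p) (8 * (2 ^ k * (K * e)))
    have h1 : 1 ≤ Mc 5 ^ 2 := by nlinarith
    nlinarith
  have hk3 : a / (128 * K * L) ≤ 2 ^ k := by
    rw [div_le_iff₀ hKL]
    rw [pow_succ] at hk2
    have : (2 : ℝ) ^ k * ((K : ℝ) * e) ≤ 2 ^ k * (2 * K * L) := by gcongr
    linarith
  have hf2 : fR μ (1 - p) (8 * (2 ^ k * (K * e))) ≤ Real.exp (-(a / (128 * K * L))) :=
    hf.trans (Real.exp_le_exp.2 (neg_le_neg hk3))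
  have hnet := net_union (c := Cb * Real.exp (-(a / (128 * K * L)))) hμ ha hab (by positivity)
    (fun x x' => (no_long_prob hμ p hν (by push_cast; linarith)
      (by push_cast; rw [pow_succ] at hk2; linarith) x x').trans
        (mul_le_mul_of_nonneg_left hf2 hCb))
  refine le_trans ?_ hnet
  have : 0 ≤ (b / a) ^ 2 * Real.exp (-(a / (128 * K * L))) := by positivity
  linarith

end FrozenPercolation
end
end

section
/- Let n ≥ 1 and let X₁, …, X_n be independent real-valued random variables such that for all 1 ≤ i ≤ n, 𝔼[X_i] = 0 and 𝔼[|X_i|^m] ≤ m! M^{m−2} σ_i²/2 for all integers m ≥ 2, for some M > 0 and reals σ_i. Then for all y ≥ 0: ℙ(|Σ_{i=1}^n X_i| ≥ y) ≤ 2 exp(−(1/2) y²/(σ² + My)), where σ² = Σ_{i=1}^n σ_i². -/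
open MeasureTheory ProbabilityTheory

lemma bernstein_aux_mgf
    {Ω : Type} [MeasurableSpace Ω] (P : Measure Ω) [IsProbabilityMeasure P]
    (X : Ω → ℝ) (M s t : ℝ) (hM : 0 < M) (hmeas : Measurable X)
    (hint : ∀ m : ℕ, 1 ≤ m → Integrable (fun ω => |X ω| ^ m) P)
    (hcent : ∫ ω, X ω ∂P = 0)
    (hmom : ∀ m : ℕ, 2 ≤ m →
      ∫ ω, |X ω| ^ m ∂P ≤ (Nat.factorial m : ℝ) * M ^ (m - 2) * s ^ 2 / 2)
    (ht : M * |t| < 1) :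
    Integrable (fun ω => Real.exp (t * X ω)) P ∧
      mgf X P t ≤ Real.exp (s ^ 2 * t ^ 2 / (2 * (1 - M * |t|))) := by
  have hexp : ∀ x : ℝ, HasSum (fun m : ℕ => x ^ m / (m.factorial : ℝ)) (Real.exp x) := by
    intro x
    rw [Real.exp_eq_exp_ℝ]
    exact NormedSpace.expSeries_div_hasSum_exp x
  have hGint : ∀ m : ℕ, Integrable (fun ω => |t * X ω| ^ m / (m.factorial : ℝ)) P := by
    intro m
    rcases Nat.eq_zero_or_pos m with rfl | hm
    · simp
    · simp only [abs_mul, mul_pow]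
      exact ((hint m hm).const_mul _).div_const _
  have hFnorm : ∀ (m : ℕ) (ω : Ω), ‖(t * X ω) ^ m / (m.factorial : ℝ)‖
      = |t * X ω| ^ m / (m.factorial : ℝ) := by
    intro m ω
    simp [abs_mul]
  have hFint : ∀ m : ℕ, Integrable (fun ω => (t * X ω) ^ m / (m.factorial : ℝ)) P := by
    intro m
    refine (hGint m).mono' (by fun_prop) (Filter.Eventually.of_forall fun ω => ?_)
    rw [hFnorm]
  have hbound : ∀ m : ℕ, ∫ ω, |t * X ω| ^ (m + 2) / ((m + 2).factorial : ℝ) ∂P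
      ≤ (s ^ 2 * t ^ 2 / 2) * (M * |t|) ^ m := by
    intro m
    have h1 := hmom (m + 2) (by omega)
    simp only [abs_mul, mul_pow]
    rw [integral_div, integral_const_mul, div_le_iff₀ (by positivity)]
    calc |t| ^ (m + 2) * ∫ ω, |X ω| ^ (m + 2) ∂P
        ≤ |t| ^ (m + 2) * (((m + 2).factorial : ℝ) * M ^ (m + 2 - 2) * s ^ 2 / 2) := by gcongr
      _ = _ := by
        rw [Nat.add_sub_cancel, pow_add |t|, sq_abs]; ring
  have hgeo : HasSum (fun m : ℕ => (s ^ 2 * t ^ 2 / 2) * (M * |t|) ^ m)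
      ((s ^ 2 * t ^ 2 / 2) * (1 - M * |t|)⁻¹) :=
    (hasSum_geometric_of_lt_one (by positivity) ht).mul_left _
  have hGsum : Summable fun m : ℕ => ∫ ω, |t * X ω| ^ m / (m.factorial : ℝ) ∂P := by
    rw [← summable_nat_add_iff 2]
    exact Summable.of_nonneg_of_le (fun m => integral_nonneg fun ω => by positivity)
      hbound hgeo.summable
  have hG := hasSum_integral_of_summable_integral_norm hGint (by
    refine hGsum.congr fun m => ?_
    congr 1; ext ω
    rw [Real.norm_of_nonneg (by positivity)])
  have hF := hasSum_integral_of_summable_integral_norm hFint (by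
    simp only [hFnorm]
    exact hGsum)
  simp only [(hexp _).tsum_eq] at hF hG
  have hGi : Integrable (fun ω => Real.exp |t * X ω|) P := by
    by_contra hcon
    rw [integral_undef hcon] at hG
    have := le_hasSum hG 0 (fun m _ => integral_nonneg fun ω => by positivity)
    simp at this
    linarith
  refine ⟨hGi.mono' (by fun_prop) (Filter.Eventually.of_forall fun ω => ?_), ?_⟩
  · rw [Real.norm_of_nonneg (Real.exp_pos _).le]
    exact Real.exp_le_exp.2 (le_abs_self _)
  · have h2 := (hasSum_nat_add_iff' 2).2 hF
    have h3 := hasSum_le (fun m => ?_) h2 hgeo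
    · simp [Finset.sum_range_succ, integral_const_mul, hcent] at h3
      have h4 : mgf X P t ≤ s ^ 2 * t ^ 2 / (2 * (1 - M * |t|)) + 1 := by
        rw [mgf]
        refine h3.trans (le_of_eq ?_)
        congr 1
        rw [← div_div, div_eq_mul_inv _ (1 - M * |t|)]
      exact h4.trans (Real.add_one_le_exp _)
    · refine le_trans ?_ (hbound m)
      refine integral_mono (hFint _) (hGint _) fun ω => ?_
      simp only
      rw [← hFnorm]
      exact le_abs_self _

/-- Bernstein's inequality under moment conditions (Lemma 4.5). -/
theorem bernstein_inequality_moments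
    {Ω : Type} [MeasurableSpace Ω] (P : Measure Ω) [IsProbabilityMeasure P]
    (n : ℕ) (hn : 1 ≤ n) (X : Fin n → Ω → ℝ) (M : ℝ) (σ : Fin n → ℝ)
    (hM : 0 < M)
    (hmeas : ∀ i, Measurable (X i))
    (hindep : iIndepFun X P)
    (hint : ∀ i, ∀ m : ℕ, 1 ≤ m → Integrable (fun ω => |X i ω| ^ m) P)
    (hcent : ∀ i, ∫ ω, X i ω ∂P = 0)
    (hmom : ∀ i, ∀ m : ℕ, 2 ≤ m →
      ∫ ω, |X i ω| ^ m ∂P ≤ (Nat.factorial m : ℝ) * M ^ (m - 2) * (σ i) ^ 2 / 2) :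
    ∀ y : ℝ, 0 ≤ y →
      (P {ω | y ≤ |∑ i, X i ω|}).toReal ≤
        2 * Real.exp (-(1 / 2) * y ^ 2 / ((∑ i, (σ i) ^ 2) + M * y)) := by
  intro y hy
  have hS0 : 0 ≤ ∑ i, (σ i) ^ 2 := Finset.sum_nonneg fun i _ => sq_nonneg _
  have key : ∀ t : ℝ, M * |t| < 1 →
      Integrable (fun ω => Real.exp (t * (∑ i, X i) ω)) P ∧
      mgf (∑ i, X i) P t ≤ Real.exp ((∑ i, (σ i) ^ 2) * t ^ 2 / (2 * (1 - M * |t|))) := by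
    intro t ht
    have h := fun i => bernstein_aux_mgf P (X i) M (σ i) t hM (hmeas i) (hint i) (hcent i)
      (hmom i) ht
    refine ⟨hindep.integrable_exp_mul_sum hmeas fun i _ => (h i).1, ?_⟩
    rw [hindep.mgf_sum hmeas, Finset.sum_mul, Finset.sum_div, Real.exp_sum]
    exact Finset.prod_le_prod (fun i _ => mgf_nonneg) fun i _ => (h i).2
  have main : ∀ t : ℝ, 0 ≤ t → M * t < 1 → (P {ω | y ≤ |∑ i, X i ω|}).toReal ≤
      2 * Real.exp (-t * y + (∑ i, (σ i) ^ 2) * t ^ 2 / (2 * (1 - M * t))) := by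
    intro t ht0 ht
    obtain ⟨i1, b1⟩ := key t (by rwa [abs_of_nonneg ht0])
    obtain ⟨i2, b2⟩ := key (-t) (by rwa [abs_neg, abs_of_nonneg ht0])
    rw [abs_of_nonneg ht0] at b1
    rw [abs_neg, abs_of_nonneg ht0, neg_sq] at b2
    have c1 := measure_ge_le_exp_mul_mgf (μ := P) y ht0 i1
    have c2 := measure_le_le_exp_mul_mgf (μ := P) (-y) (neg_nonpos.2 ht0) i2
    have hsub : {ω | y ≤ |∑ i, X i ω|} ⊆
        {ω | y ≤ (∑ i, X i) ω} ∪ {ω | (∑ i, X i) ω ≤ -y} := by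
      intro ω hω
      simp only [Set.mem_setOf_eq, Set.mem_union, Finset.sum_apply] at hω ⊢
      rcases le_abs.1 hω with h | h
      · exact Or.inl h
      · exact Or.inr (by linarith)
    have c3 : P.real {ω | y ≤ |∑ i, X i ω|} ≤ _ :=
      (measureReal_mono hsub).trans (measureReal_union_le _ _)
    rw [Real.exp_add]
    have d1 := mul_le_mul_of_nonneg_left b1 (Real.exp_pos (-t * y)).le
    have d2 := mul_le_mul_of_nonneg_left b2 (Real.exp_pos (-t * y)).le
    rw [show - -t * -y = -t * y by ring] at c2
    change P.real _ ≤ _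
    linarith
  rcases hS0.eq_or_lt with hS | hS
  · rcases hy.eq_or_lt with rfl | hy'
    · refine (main 0 le_rfl (by simp)).trans (le_of_eq ?_)
      simp
    · refine (main (1 / (2 * M)) (by positivity) (by field_simp; norm_num)).trans (le_of_eq ?_)
      rw [← hS]
      congr 2
      field_simp
      ring
  · have hD : 0 < (∑ i, (σ i) ^ 2) + M * y := by positivity
    generalize (∑ i, (σ i) ^ 2) = S at *
    refine (main (y / (S + M * y)) (by positivity) ?_).trans (le_of_eq ?_)
    · rw [← mul_div_assoc, div_lt_one hD]; linarith
    · congr 2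
      have : 1 - M * (y / (S + M * y)) = S / (S + M * y) := by field_simp; ring
      rw [this]
      field_simp
      ring
end

section
/- Let ε > 0 and let (Y_i)_{1 ≤ i ≤ n} be independent Bernoulli random variables with parameters r_i ∈ (ε, 1−ε). Suppose f_n : {0,1}^n → ℝ satisfies: for all 1 ≤ i ≤ n and all ω ∈ {0,1}^n, f_n(ω^{(i)}) − f_n(ω_{(i)}) ≥ 1, where ω^{(i)} (resp. ω_{(i)}) is ω with i-th coordinate set to 1 (resp. 0). Then there exists a constant c = c(ε) ∈ (0,∞), depending only on ε, such that for every n ≥ 1 and every interval I ⊆ ℝ of length |I|: ℙ(f_n(Y₁, …, Y_n) ∈ I) ≤ c n^{−1/2} (|I| + 1). -/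
open MeasureTheory ProbabilityTheory

lemma aux_integrable {n : ℕ} {Ω : Type} [MeasurableSpace Ω] (P : Measure Ω) [IsProbabilityMeasure P]
    (Y : Fin n → Ω → Bool) (hY : ∀ i, Measurable (Y i)) (H : (Fin n → Bool) → ℝ) :
    Integrable (fun ω => H (fun i => Y i ω)) P := by
  have hm : Measurable (fun ω => (fun i => Y i ω : Fin n → Bool)) := measurable_pi_lambda _ hY
  have hH : Measurable H := measurable_of_finite H
  refine Integrable.of_bound (C := ∑ x, |H x|) (hH.comp hm).aestronglyMeasurable ?_
  refine Filter.Eventually.of_forall fun ω => ?_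
  exact Finset.single_le_sum (f := fun x => |H x|) (fun x _ => abs_nonneg _) (Finset.mem_univ _)

lemma aux_indep {n : ℕ} {Ω : Type} [MeasurableSpace Ω] (P : Measure Ω) [IsProbabilityMeasure P]
    (Y : Fin n → Ω → Bool) (hY : ∀ i, Measurable (Y i)) (hI : iIndepFun Y P)
    (i : Fin n) (H : (Fin n → Bool) → ℝ) (hH : ∀ x b, H (Function.update x i b) = H x)
    (φ : Bool → ℝ) :
    ∫ ω, H (fun j => Y j ω) * φ (Y i ω) ∂P =
      (∫ ω, H (fun j => Y j ω) ∂P) * ∫ ω, φ (Y i ω) ∂P := by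
  classical
  have h := hI.indepFun_finset ({i}ᶜ) {i} disjoint_compl_left hY
  let ext : ((({i}ᶜ : Finset (Fin n))) → Bool) → (Fin n → Bool) :=
    fun y j => if hj : j ∈ ({i}ᶜ : Finset (Fin n)) then y ⟨j, hj⟩ else false
  have h2 := h.comp (φ := fun y => H (ext y)) (ψ := fun y => φ (y ⟨i, by simp⟩))
    (measurable_of_finite _) (measurable_of_finite _)
  have e1 : ((fun y => H (ext y)) ∘ fun ω (j : ({i}ᶜ : Finset (Fin n))) => Y j ω)
      = fun ω => H (fun j => Y j ω) := by
    funext ω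
    simp only [Function.comp]
    rw [← hH (fun j => Y j ω) false]
    congr 1
    funext j
    by_cases hj : j = i
    · subst hj; simp [ext]
    · simp [ext, hj]
  rw [e1] at h2
  exact h2.integral_mul_eq_mul_integral
    (aux_integrable P Y hY H).aestronglyMeasurable
    (aux_integrable P Y hY (fun x => φ (x i))).aestronglyMeasurable

/-- real value of a bit -/
noncomputable def bv (b : Bool) : ℝ := if b then 1 else 0

lemma aux_mean {n : ℕ} {Ω : Type} [MeasurableSpace Ω] (P : Measure Ω) [IsProbabilityMeasure P]
    (Y : Fin n → Ω → Bool) (hY : ∀ i, Measurable (Y i)) (i : Fin n) (r : ℝ) (hr : 0 ≤ r)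
    (h : P {ω | Y i ω = true} = ENNReal.ofReal r) : ∫ ω, bv (Y i ω) ∂P = r := by
  have hm : MeasurableSet {ω | Y i ω = true} := hY i (measurableSet_singleton true)
  have : (fun ω => bv (Y i ω)) = Set.indicator {ω | Y i ω = true} (fun _ => (1 : ℝ)) := by
    funext ω; simp [bv, Set.indicator]
  rw [this, integral_indicator hm]
  simp [Measure.real, h, hr]

lemma aux_grad {n : ℕ} {Ω : Type} [MeasurableSpace Ω] (P : Measure Ω) [IsProbabilityMeasure P]
    (Y : Fin n → Ω → Bool) (hY : ∀ i, Measurable (Y i)) (hI : iIndepFun Y P)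
    (i : Fin n) (r : ℝ) (hr : 0 ≤ r)
    (h : P {ω | Y i ω = true} = ENNReal.ofReal r) (g : (Fin n → Bool) → ℝ) :
    ∫ ω, g (fun j => Y j ω) * (bv (Y i ω) - r) ∂P = r * (1 - r) *
      ∫ ω, (g (Function.update (fun j => Y j ω) i true)
        - g (Function.update (fun j => Y j ω) i false)) ∂P := by
  have hmean := aux_mean P Y hY i r hr h
  have hbi := aux_integrable P Y hY (fun x => bv (x i))
  have h1 := aux_indep P Y hY hI i (fun x => g (Function.update x i false)) (by simp)
    (fun b => bv b - r)
  have h2 := aux_indep P Y hY hI i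
    (fun x => g (Function.update x i true) - g (Function.update x i false)) (by simp)
    (fun b => (1 - r) * bv b)
  have m1 : ∫ ω, (bv (Y i ω) - r) ∂P = 0 := by
    rw [integral_sub hbi (integrable_const _), hmean]; simp
  have m2 : ∫ ω, (1 - r) * bv (Y i ω) ∂P = (1 - r) * r := by
    rw [integral_const_mul, hmean]
  simp only [m1, m2] at h1 h2
  have key : ∀ ω, g (fun j => Y j ω) * (bv (Y i ω) - r) =
      g (Function.update (fun j => Y j ω) i false) * (bv (Y i ω) - r) +
      (g (Function.update (fun j => Y j ω) i true)
        - g (Function.update (fun j => Y j ω) i false)) * ((1 - r) * bv (Y i ω)) := by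
    intro ω
    have hu : Function.update (fun j => Y j ω) i (Y i ω) = fun j => Y j ω :=
      Function.update_eq_self i (fun j => Y j ω)
    cases hb : Y i ω
    · rw [hb] at hu; rw [hu]; simp [bv]
    · rw [hb] at hu; rw [hu]; simp only [bv, if_true]; ring
  simp_rw [key]
  rw [integral_add
    (aux_integrable P Y hY (fun x => g (Function.update x i false) * (bv (x i) - r)))
    (aux_integrable P Y hY (fun x => (g (Function.update x i true)
      - g (Function.update x i false)) * ((1 - r) * bv (x i)))), h1, h2]
  ring

lemma aux_var {n : ℕ} {Ω : Type} [MeasurableSpace Ω] (P : Measure Ω) [IsProbabilityMeasure P]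
    (Y : Fin n → Ω → Bool) (hY : ∀ i, Measurable (Y i)) (hI : iIndepFun Y P)
    (r : Fin n → ℝ) (hr : ∀ i, 0 ≤ r i) 
    (h : ∀ i, P {ω | Y i ω = true} = ENNReal.ofReal (r i)) :
    ∫ ω, (∑ i, (bv (Y i ω) - r i)) ^ 2 ∂P ≤ n / 4 := by
  have hmem : ∀ i, MemLp (fun ω => bv (Y i ω)) 2 P := by
    intro i
    refine MemLp.of_bound (aux_integrable P Y hY (fun x => bv (x i))).aestronglyMeasurable 1 ?_
    refine Filter.Eventually.of_forall fun ω => ?_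
    cases hb : Y i ω <;> simp [bv]
  have hv := IndepFun.variance_sum (μ := P) (X := fun i ω => bv (Y i ω)) (s := Finset.univ)
    (fun i _ => hmem i) (by
      intro i _ j _ hij
      exact (hI.indepFun hij).comp (measurable_of_finite bv) (measurable_of_finite bv))
  have hle : ∀ i, Var[fun ω => bv (Y i ω); P] ≤ 1 / 4 := by
    intro i
    have := variance_le_sq_of_bounded (μ := P) (X := fun ω => bv (Y i ω)) (a := 0) (b := 1)
      (Filter.Eventually.of_forall fun ω => by cases hb : Y i ω <;> simp [bv])
      (hmem i).aestronglyMeasurable.aemeasurable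
    norm_num at this ⊢
    exact this
  have hm : ∫ ω, (∑ i, fun ω => bv (Y i ω)) ω ∂P = ∑ i, r i := by
    simp only [Finset.sum_apply]
    rw [integral_finset_sum _ (fun i _ => aux_integrable P Y hY (fun x => bv (x i)))]
    exact Finset.sum_congr rfl fun i _ => aux_mean P Y hY i (r i) (hr i) (h i)
  rw [variance_eq_integral (Finset.aemeasurable_sum _
    (fun i _ => (hmem i).aestronglyMeasurable.aemeasurable)), hm] at hv
  simp only [Finset.sum_apply, ← Finset.sum_sub_distrib] at hv
  rw [hv]
  calc _ ≤ ∑ i : Fin n, (1 / 4 : ℝ) := Finset.sum_le_sum fun i _ => hle i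
    _ = n / 4 := by simp; ring

theorem bernoulli_deconcentration :
    ∀ ε : ℝ, 0 < ε → ∃ c : ℝ, 0 < c ∧
      ∀ n : ℕ, 1 ≤ n →
      ∀ (Ω : Type) (_ : MeasurableSpace Ω) (P : Measure Ω), IsProbabilityMeasure P →
      ∀ (Y : Fin n → Ω → Bool) (r : Fin n → ℝ),
        (∀ i, Measurable (Y i)) →
        iIndepFun Y P →
        (∀ i, ε < r i ∧ r i < 1 - ε) →
        (∀ i, P {ω | Y i ω = true} = ENNReal.ofReal (r i)) →
        ∀ f : (Fin n → Bool) → ℝ,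
          (∀ (i : Fin n) (b : Fin n → Bool),
            1 ≤ f (Function.update b i true) - f (Function.update b i false)) →
          ∀ a b : ℝ, a ≤ b →
            (P {ω | f (fun i => Y i ω) ∈ Set.Icc a b}).toReal ≤
              c / Real.sqrt n * ((b - a) + 1) := by
  intro ε hε
  refine ⟨1 / ε ^ 2, by positivity, ?_⟩
  intro n hn Ω _ P _ Y r hY hI hr hP f hf a b hab
  have hr0 : ∀ i, 0 ≤ r i := fun i => (hε.trans (hr i).1).le
  set L : ℝ := (b - a) / 2 + 1 with hL
  set g : (Fin n → Bool) → ℝ := fun x => max (-L) (min L (f x - (a + b) / 2)) with hg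
  have hgL : ∀ x, |g x| ≤ L := by
    intro x
    rw [abs_le]
    refine ⟨le_max_left _ _, max_le (by linarith) (min_le_left _ _)⟩
  set p : ℝ := (P {ω | f (fun i => Y i ω) ∈ Set.Icc a b}).toReal with hp
  have hp0 : 0 ≤ p := ENNReal.toReal_nonneg
  have hpint : ∫ ω, Set.indicator {x | f x ∈ Set.Icc a b} (fun _ => (1 : ℝ)) (fun i => Y i ω) ∂P
      = p := by
    have hm : Measurable (fun ω => (fun i => Y i ω : Fin n → Bool)) := measurable_pi_lambda _ hY
    have hs : MeasurableSet {ω | f (fun i => Y i ω) ∈ Set.Icc a b} :=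
      hm (Set.toFinite {x | f x ∈ Set.Icc a b}).measurableSet
    have : (fun ω => Set.indicator {x | f x ∈ Set.Icc a b} (fun _ => (1 : ℝ)) (fun i => Y i ω))
      = Set.indicator {ω | f (fun i => Y i ω) ∈ Set.Icc a b} (fun _ => (1 : ℝ)) := by
      funext ω; simp [Set.indicator]
    rw [this, integral_indicator hs]
    simp [Measure.real, hp]
  have hpt : ∀ i x, Set.indicator {x | f x ∈ Set.Icc a b} (fun _ => (1 : ℝ)) x ≤
      g (Function.update x i true) - g (Function.update x i false) := by
    intro i x
    have h1 := hf i x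
    have hu : Function.update x i (x i) = x := Function.update_eq_self i x
    by_cases hx : x ∈ {x | f x ∈ Set.Icc a b}
    · rw [Set.indicator_of_mem hx]
      obtain ⟨hxa, hxb⟩ := hx
      cases hb : x i <;> rw [hb] at hu <;> rw [← hu] at hxa hxb <;> simp only [hg] <;>
        grind
    · rw [Set.indicator_of_notMem hx]
      have : g (Function.update x i false) ≤ g (Function.update x i true) := by
        simp only [hg]
        gcongr
        linarith
      linarith
  have hgrad : ∀ i, ε ^ 2 * p ≤ ∫ ω, g (fun j => Y j ω) * (bv (Y i ω) - r i) ∂P := by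
    intro i
    rw [aux_grad P Y hY hI i (r i) (hr0 i) (hP i) g]
    have hmono : p ≤ ∫ ω, (g (Function.update (fun j => Y j ω) i true)
        - g (Function.update (fun j => Y j ω) i false)) ∂P := by
      rw [← hpint]
      refine integral_mono (aux_integrable P Y hY _)
        (aux_integrable P Y hY (fun x => g (Function.update x i true)
        - g (Function.update x i false))) fun ω => hpt i _
    have : ε ^ 2 ≤ r i * (1 - r i) := by nlinarith [hr i]
    exact mul_le_mul this hmono hp0 (le_trans (by positivity) this)
  have hsn : 0 < Real.sqrt n := Real.sqrt_pos.2 (by exact_mod_cast hn)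
  have hsq : Real.sqrt n * Real.sqrt n = n := Real.mul_self_sqrt (by positivity)
  set s := Real.sqrt n with hs
  have hsum : n * (ε ^ 2 * p) ≤ ∫ ω, g (fun j => Y j ω) * (∑ i, (bv (Y i ω) - r i)) ∂P := by
    simp_rw [Finset.mul_sum]
    rw [integral_finset_sum _ (fun i _ =>
      aux_integrable P Y hY (fun x => g x * (bv (x i) - r i)))]
    calc (n : ℝ) * (ε ^ 2 * p) = ∑ i : Fin n, ε ^ 2 * p := by simp
      _ ≤ _ := Finset.sum_le_sum fun i _ => hgrad i
  have hupper : ∫ ω, g (fun j => Y j ω) * (∑ i, (bv (Y i ω) - r i)) ∂P ≤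
      ∫ ω, (L / (2 * s) * (∑ i, (bv (Y i ω) - r i)) ^ 2 + L * s / 2) ∂P := by
    refine integral_mono (aux_integrable P Y hY (fun x => g x * (∑ i, (bv (x i) - r i))))
      (aux_integrable P Y hY (fun x =>
        L / (2 * s) * (∑ i, (bv (x i) - r i)) ^ 2 + L * s / 2)) fun ω => ?_
    simp only
    generalize (∑ i, (bv (Y i ω) - r i)) = S
    have h1 : g (fun j => Y j ω) * S ≤ L * |S| := by
      refine (le_abs_self _).trans ?_
      rw [abs_mul]
      exact mul_le_mul_of_nonneg_right (hgL _) (abs_nonneg _)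
    have hL0 : 0 ≤ L := by linarith
    have h2 : L / (2 * s) * S ^ 2 + L * s / 2 - L * |S| = L / (2 * s) * (|S| - s) ^ 2 := by
      rw [← sq_abs S]; field_simp; ring
    have h3 : 0 ≤ L / (2 * s) * (|S| - s) ^ 2 := by positivity
    linarith
  have hL0 : 0 ≤ L := by linarith
  rw [integral_add (aux_integrable P Y hY (fun x => L / (2 * s) * (∑ i, (bv (x i) - r i)) ^ 2))
    (integrable_const _), integral_const_mul] at hupper
  have hv := aux_var P Y hY hI r hr0 hP
  have h5 : L / (2 * s) * ∫ ω, (∑ i, (bv (Y i ω) - r i)) ^ 2 ∂P ≤ L / (2 * s) * (n / 4) :=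
    mul_le_mul_of_nonneg_left hv (by positivity)
  have h6 : L / (2 * s) * (n / 4) = L * s / 8 := by rw [← hsq]; field_simp; ring
  simp only [integral_const, probReal_univ, one_smul] at hupper
  have h7 : s * (s * (ε ^ 2 * p)) ≤ s * (b - a + 1) := by
    rw [← mul_assoc, hsq]
    nlinarith
  have h8 := le_of_mul_le_mul_left h7 hsn
  rw [div_div, one_div_mul_eq_div, le_div_iff₀ (by positivity)]
  linarith
end
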